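/- arXiv:2101.09867 — 3 statements merged into one kernel-verified Lean document; each statement's English description precedes it below -/
import Mathlib

section
/- Let j, m ≥ 1 be integers and let M_1, …, M_j ∈ C^m([0,∞), ℝ). Then the iterated convolution M_1 * ⋯ * M_j belongs to C^{m+j-1}([0,∞)), and for every integer k with 0 ≤ k ≤ m+j-1 and every t > 0 one has |d^k/dt^k (M_1 * ⋯ * M_j)(t)| ≤ (∑_{l=max{0, j-1-k}}^{j-1} t^l/l!) · ∏_{l=1}^{j} ‖M_l‖_{C^p([0,t])}, where p := 0 if k = 0, and p := max{k-j+1, 1} if k ≥ 1. -/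
open Set MeasureTheory

/-- Convolution on `[0,∞)` (via signed interval integral): `(f*g)(t) = ∫_0^t f(t-s) g(s) ds`. -/
noncomputable def conv (f g : ℝ → ℝ) : ℝ → ℝ :=
  fun t => ∫ s in (0:ℝ)..t, f (t - s) * g s

/-- `j`-fold convolution power of `M`, with the conventions `M^{*0} = 0` and `M^{*1} = M`. -/
noncomputable def convPow (M : ℝ → ℝ) : ℕ → ℝ → ℝ
  | 0 => fun _ => 0
  | 1 => M
  | (j+2) => conv M (convPow M (j+1))

/-- The norm `‖f‖_{C^k([0,t])} = ∑_{l=0}^k max_{0 ≤ τ ≤ t} |f^{(l)}(τ)|`,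
derivatives taken within `[0,∞)`. -/
noncomputable def CkNorm (k : ℕ) (t : ℝ) (f : ℝ → ℝ) : ℝ :=
  ∑ l ∈ Finset.range (k+1), ⨆ τ : Set.Icc (0:ℝ) t, |iteratedDerivWithin l f (Set.Ici 0) τ|

/-- Iterated convolution `M_1 * ⋯ * M_j` of a list of functions (empty list ↦ 0). -/
noncomputable def convList : List (ℝ → ℝ) → ℝ → ℝ
  | [] => fun _ => 0
  | [f] => f
  | f :: g :: fs => conv f (convList (g :: fs))

theorem conv_comm (f g : ℝ → ℝ) : conv f g = conv g f := by
  ext t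
  have h := intervalIntegral.integral_comp_sub_left (a := 0) (b := t)
    (fun s => f (t - s) * g s) t
  simp only [sub_sub_cancel, sub_self, sub_zero] at h
  simp only [conv, ← h]
  simp only [mul_comm]

theorem conv_congr {f f₁ g g₁ : ℝ → ℝ} (hf : EqOn f f₁ (Ici 0)) (hg : EqOn g g₁ (Ici 0)) :
    EqOn (conv f g) (conv f₁ g₁) (Ici 0) := by
  intro t ht
  refine intervalIntegral.integral_congr fun s hs => ?_
  rw [uIcc_of_le ht] at hs
  simp only [hf (show t - s ∈ Ici 0 from sub_nonneg.2 hs.2), hg (show s ∈ Ici 0 from hs.1)]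

theorem continuous_comp_max {g : ℝ → ℝ} (hg : ContinuousOn g (Ici 0)) :
    Continuous fun x => g (max x 0) :=
  hg.comp_continuous (by fun_prop) fun x => le_max_right x 0

theorem eqOn_comp_max (g : ℝ → ℝ) : EqOn g (fun x => g (max x 0)) (Ici 0) := fun x hx => by
  simp only [max_eq_left (show (0 : ℝ) ≤ x from hx)]

theorem continuousOn_conv {f g : ℝ → ℝ} (hf : ContinuousOn f (Ici 0))
    (hg : ContinuousOn g (Ici 0)) : ContinuousOn (conv f g) (Ici 0) := by
  have hf' := continuous_comp_max hf
  have hg' := continuous_comp_max hg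
  refine ContinuousOn.congr (Continuous.continuousOn ?_)
    (conv_congr (eqOn_comp_max f) (eqOn_comp_max g))
  exact intervalIntegral.continuous_parametric_intervalIntegral_of_continuous
    ((hf'.comp (continuous_fst.sub continuous_snd)).mul (hg'.comp continuous_snd)) continuous_id

theorem hasDerivAt_integral_diagonal {φ : ℝ → ℝ → ℝ} (hφ : Continuous (Function.uncurry φ))
    (t : ℝ) : HasDerivAt (fun x => ∫ s in t..x, φ x s) (φ t t) t := by
  rw [hasDerivAt_iff_isLittleO, Asymptotics.isLittleO_iff]
  intro ε hε
  obtain ⟨δ, hδ, h⟩ := Metric.continuousAt_iff.1 (hφ.continuousAt (x := (t, t))) ε hε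
  filter_upwards [Metric.ball_mem_nhds t hδ] with x hx
  have hint : IntervalIntegrable (φ x) volume t x :=
    (hφ.comp (by fun_prop : Continuous fun s => (x, s))).intervalIntegrable _ _
  have heq : (∫ s in t..x, φ x s) - (∫ s in t..t, φ t s) - (x - t) • φ t t =
      ∫ s in t..x, (φ x s - φ t t) := by
    rw [intervalIntegral.integral_sub hint (by simp)]
    simp
  rw [heq, Real.norm_eq_abs (x - t)]
  refine intervalIntegral.norm_integral_le_of_norm_le_const fun s hs => ?_
  have hs' : |s - t| ≤ |x - t| := by
    rcases le_total t x with htx | htx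
    · rw [uIoc_of_le htx] at hs
      rw [abs_of_nonneg (by linarith [hs.1]), abs_of_nonneg (by linarith)]
      linarith [hs.2]
    · rw [uIoc_of_ge htx] at hs
      rw [abs_of_nonpos (by linarith [hs.2]), abs_of_nonpos (by linarith)]
      linarith [hs.1]
  rw [Metric.mem_ball, Real.dist_eq] at hx
  refine (h (x := (x, s)) ?_).le
  rw [Prod.dist_eq, max_lt_iff]
  exact ⟨hx, hs'.trans_lt hx⟩

theorem hasDerivAt_conv {f f' g : ℝ → ℝ} (hf : ∀ x, HasDerivAt f (f' x) x) (hf' : Continuous f')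
    (hg : Continuous g) (t : ℝ) : HasDerivAt (conv f g) (f 0 * g t + conv f' g t) t := by
  have hfc : Continuous f := continuous_iff_continuousAt.2 fun x => (hf x).continuousAt
  have hsplit : conv f g =
      fun x => (∫ s in t..x, f (x - s) * g s) + ∫ s in (0 : ℝ)..t, f (x - s) * g s := by
    ext x
    rw [conv, add_comm, intervalIntegral.integral_add_adjacent_intervals] <;>
      exact Continuous.intervalIntegrable (by fun_prop) _ _
  rw [hsplit]
  have h₁ := hasDerivAt_integral_diagonal (φ := fun x s => f (x - s) * g s)
    (by simp only [Function.uncurry_def]; fun_prop) t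
  simp only [sub_self] at h₁
  refine h₁.add ?_
  have hK : IsCompact ((Icc (t - 1) (t + 1)) ×ˢ (uIcc 0 t)) := isCompact_Icc.prod isCompact_uIcc
  obtain ⟨C, hC⟩ := hK.exists_bound_of_continuousOn
    (f := fun p : ℝ × ℝ => f' (p.1 - p.2) * g p.2) (by fun_prop)
  refine (intervalIntegral.hasDerivAt_integral_of_dominated_loc_of_deriv_le
    (F := fun x s => f (x - s) * g s) (F' := fun x s => f' (x - s) * g s) (bound := fun _ => C)
    (Icc_mem_nhds (by linarith : t - 1 < t) (by linarith : t < t + 1))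
    (.of_forall fun x => ?_) ?_ ?_ ?_ ?_ ?_).2
  · exact Continuous.aestronglyMeasurable (by fun_prop)
  · exact Continuous.intervalIntegrable (by fun_prop) _ _
  · exact Continuous.aestronglyMeasurable (by fun_prop)
  · exact .of_forall fun s hs x hx => hC (x, s) ⟨hx, uIoc_subset_uIcc hs⟩
  · simp
  · refine .of_forall fun s _ x _ => ?_
    have := (hf (x - s)).comp x ((hasDerivAt_id x).sub_const s)
    simpa using this.mul_const (g s)

theorem hasDerivWithinAt_conv {f f' g : ℝ → ℝ}
    (hf : ∀ x ∈ Ici (0 : ℝ), HasDerivWithinAt f (f' x) (Ici 0) x)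
    (hf' : ContinuousOn f' (Ici 0)) (hg : ContinuousOn g (Ici 0)) {t : ℝ} (ht : t ∈ Ici (0 : ℝ)) :
    HasDerivWithinAt (conv f g) (f 0 * g t + conv f' g t) (Ici 0) t := by
  have hF' := continuous_comp_max hf'
  have hF : ∀ x, HasDerivAt (fun x => f 0 + ∫ s in (0 : ℝ)..x, f' (max s 0)) (f' (max x 0)) x :=
    fun x => (intervalIntegral.integral_hasDerivAt_right (hF'.intervalIntegrable _ _)
      (hF'.stronglyMeasurableAtFilter _ _) hF'.continuousAt).const_add _
  have hfF : EqOn f (fun x => f 0 + ∫ s in (0 : ℝ)..x, f' (max s 0)) (Ici 0) := by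
    intro x hx
    have := intervalIntegral.integral_eq_sub_of_hasDeriv_right_of_le
      (f := f) (f' := fun s => f' (max s 0)) (show (0 : ℝ) ≤ x from hx)
      (fun y hy => (hf y hy.1).continuousWithinAt.mono Icc_subset_Ici_self)
      (fun y hy => by
        rw [max_eq_left hy.1.le]
        exact (hf y hy.1.le).mono (Ioi_subset_Ici hy.1.le)) (hF'.intervalIntegrable _ _)
    simp only [this]
    ring
  have hgG := eqOn_comp_max g
  have key := (hasDerivAt_conv hF hF' (continuous_comp_max hg) t).hasDerivWithinAt (s := Ici 0)
  rw [← conv_congr (eqOn_comp_max f') hgG ht] at key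
  simp only [intervalIntegral.integral_same, add_zero, ← hgG ht] at key
  exact key.congr_of_mem (conv_congr hfF hgG) ht

theorem contDiffOn_and_iteratedDerivWithin_of_hasDerivWithinAt {s : Set ℝ} (hs : UniqueDiffOn ℝ s)
    {N : ℕ} {H : ℕ → ℝ → ℝ}
    (hH : ∀ r < N, ∀ x ∈ s, HasDerivWithinAt (H r) (H (r + 1) x) s x)
    (hN : ContinuousOn (H N) s) :
    ContDiffOn ℝ N (H 0) s ∧ ∀ r ≤ N, EqOn (iteratedDerivWithin r (H 0) s) (H r) s := by
  have heq : ∀ r ≤ N, EqOn (iteratedDerivWithin r (H 0) s) (H r) s := by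
    intro r
    induction r with
    | zero => intro _ x _; simp
    | succ r ih =>
      intro hr x hx
      rw [iteratedDerivWithin_succ, derivWithin_congr (ih (by omega)) (ih (by omega) hx)]
      exact (hH r hr x hx).derivWithin (hs x hx)
  refine ⟨?_, heq⟩
  rw [contDiffOn_nat_iff_continuousOn_differentiableOn_deriv hs]
  refine ⟨fun r hr => ?_, fun r hr => ?_⟩
  · refine ContinuousOn.congr ?_ (heq r hr)
    rcases hr.lt_or_eq with h | rfl
    · exact fun x hx => (hH r h x hx).continuousWithinAt
    · exact hN
  · exact DifferentiableOn.congr (fun x hx => (hH r hr x hx).differentiableWithinAt) (heq r hr.le)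

theorem ContDiffOn.hasDerivWithinAt_iteratedDerivWithin {s : Set ℝ} (hs : UniqueDiffOn ℝ s)
    {f : ℝ → ℝ} {n i : ℕ} (hf : ContDiffOn ℝ n f s) (hi : i < n) {x : ℝ} (hx : x ∈ s) :
    HasDerivWithinAt (iteratedDerivWithin i f s) (iteratedDerivWithin (i + 1) f s x) s x := by
  rw [iteratedDerivWithin_succ]
  exact (hf.differentiableOn_iteratedDerivWithin (by exact_mod_cast hi) hs x hx).hasDerivWithinAt

theorem ContDiffOn.conv_Ici {f g : ℝ → ℝ} {m n : ℕ} (hm : 1 ≤ m)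
    (hf : ContDiffOn ℝ m f (Ici 0)) (hg : ContDiffOn ℝ (m + n : ℕ) g (Ici 0))
    (hg₀ : ∀ r < n, iteratedDerivWithin r g (Ici 0) 0 = 0) :
    ContDiffOn ℝ (m + n + 1 : ℕ) (conv f g) (Ici 0) ∧
      ∀ r ≤ m + n, ∀ x ∈ Ici (0 : ℝ), iteratedDerivWithin (r + 1) (conv f g) (Ici 0) x =
        f 0 * iteratedDerivWithin r g (Ici 0) x +
          conv (iteratedDerivWithin 1 f (Ici 0)) (iteratedDerivWithin r g (Ici 0)) x +
          ∑ i ∈ Finset.range r, iteratedDerivWithin (i + 1) f (Ici 0) x *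
            iteratedDerivWithin (r - 1 - i) g (Ici 0) 0 := by
  have hs : UniqueDiffOn ℝ (Ici (0 : ℝ)) := uniqueDiffOn_Ici 0
  set D : ℕ → (ℝ → ℝ) → ℝ → ℝ := fun i f => iteratedDerivWithin i f (Ici 0) with hD
  have hfc : ∀ i ≤ m, ContinuousOn (D i f) (Ici 0) := fun i hi =>
    hf.continuousOn_iteratedDerivWithin (by exact_mod_cast hi) hs
  have hgc : ∀ i ≤ m + n, ContinuousOn (D i g) (Ici 0) := fun i hi =>
    hg.continuousOn_iteratedDerivWithin (by exact_mod_cast hi) hs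
  have hfd : ∀ i < m, ∀ x ∈ Ici (0 : ℝ), HasDerivWithinAt (D i f) (D (i + 1) f x) (Ici 0) x :=
    fun i hi x hx => hf.hasDerivWithinAt_iteratedDerivWithin hs hi hx
  have hgd : ∀ i < m + n, ∀ x ∈ Ici (0 : ℝ),
      HasDerivWithinAt (D i g) (D (i + 1) g x) (Ici 0) x :=
    fun i hi x hx => hg.hasDerivWithinAt_iteratedDerivWithin hs hi hx
  let H : ℕ → ℝ → ℝ := fun k => k.casesOn (conv f g) fun r x =>
    f 0 * D r g x + conv (D 1 f) (D r g) x +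
      ∑ i ∈ Finset.range r, D (i + 1) f x * D (r - 1 - i) g 0
  have key := contDiffOn_and_iteratedDerivWithin_of_hasDerivWithinAt hs (N := m + n + 1) (H := H)
    ?_ ?_
  · exact ⟨key.1, fun r hr => key.2 (r + 1) (by omega)⟩
  · rintro (_ | r) hr x hx
    · have := hasDerivWithinAt_conv (hfd 0 hm) (hfc 1 hm) (hgc 0 (by omega)) hx
      simpa [H, hD] using this
    · have h₁ := (hgd r (by omega) x hx).const_mul (f 0)
      have h₂ := hasDerivWithinAt_conv (hgd r (by omega)) (hgc (r + 1) (by omega)) (hfc 1 hm) hx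
      rw [conv_comm, conv_comm (D (r + 1) g)] at h₂
      have h₃ : HasDerivWithinAt
          (fun x => ∑ i ∈ Finset.range r, D (i + 1) f x * D (r - 1 - i) g 0)
          (∑ i ∈ Finset.range r, D (i + 2) f x * D (r - 1 - i) g 0) (Ici 0) x := by
        refine HasDerivWithinAt.fun_sum fun i hi => ?_
        rw [Finset.mem_range] at hi
        by_cases him : i + 1 < m
        · exact (hfd (i + 1) him x hx).mul_const _
        · have h0 : D (r - 1 - i) g 0 = 0 := hg₀ _ (by omega)
          simpa [h0] using hasDerivWithinAt_const x (Ici 0) (0 : ℝ)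
      refine ((h₁.add h₂).add h₃).congr_deriv ?_
      change _ = f 0 * D (r + 1) g x + conv (D 1 f) (D (r + 1) g) x +
        ∑ i ∈ Finset.range (r + 1), D (i + 1) f x * D (r + 1 - 1 - i) g 0
      rw [Finset.sum_range_succ']
      simp only [Nat.add_sub_cancel, Nat.sub_zero, zero_add, add_assoc, one_add_one_eq_two,
        Nat.sub_sub, Nat.add_comm 1]
      ring
  · refine ((continuousOn_const.mul (hgc _ le_rfl)).add
      (continuousOn_conv (hfc 1 hm) (hgc _ le_rfl))).add (continuousOn_finsetSum _ fun i hi => ?_)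
    rw [Finset.mem_range] at hi
    by_cases him : i + 1 ≤ m
    · exact (hfc _ him).mul continuousOn_const
    · have h0 : D (m + n - 1 - i) g 0 = 0 := hg₀ _ (by omega)
      simpa [h0] using continuousOn_const

theorem abs_conv_le {f g : ℝ → ℝ} {a P t : ℝ} {s : Finset ℕ} (ht : 0 ≤ t) (ha : 0 ≤ a)
    (hf : ∀ x ∈ Icc 0 t, |f x| ≤ a)
    (hg : ∀ x ∈ Icc 0 t, |g x| ≤ (∑ l ∈ s, x ^ l / (l.factorial : ℝ)) * P) :
    |conv f g t| ≤ a * ((∑ l ∈ s, t ^ (l + 1) / ((l + 1).factorial : ℝ)) * P) := by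
  have h := intervalIntegral.norm_integral_le_of_norm_le (μ := volume)
    (f := fun x => f (t - x) * g x)
    (g := fun x => a * ((∑ l ∈ s, x ^ l / (l.factorial : ℝ)) * P)) ht
    (.of_forall fun x hx => ?_) (Continuous.intervalIntegrable (by fun_prop) _ _)
  · refine h.trans_eq ?_
    rw [intervalIntegral.integral_const_mul, intervalIntegral.integral_mul_const,
      intervalIntegral.integral_finsetSum
        fun i _ => Continuous.intervalIntegrable (by fun_prop) _ _]
    congr 2
    refine Finset.sum_congr rfl fun l _ => ?_
    rw [intervalIntegral.integral_div, integral_pow, Nat.factorial_succ]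
    push_cast
    field_simp
    simp
  · rw [norm_mul]
    exact mul_le_mul (hf _ ⟨sub_nonneg.2 hx.2, by linarith [hx.1]⟩) (hg x ⟨hx.1.le, hx.2⟩)
      (norm_nonneg _) ha

theorem bddAbove_range_abs_iteratedDerivWithin {f : ℝ → ℝ} {m l : ℕ}
    (hf : ContDiffOn ℝ m f (Ici 0)) (hl : l ≤ m) (t : ℝ) :
    BddAbove (range fun τ : Icc (0 : ℝ) t => |iteratedDerivWithin l f (Ici 0) τ|) := by
  have hc := (hf.continuousOn_iteratedDerivWithin (by exact_mod_cast hl)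
    (uniqueDiffOn_Ici 0)).mono (Icc_subset_Ici_self : Icc 0 t ⊆ Ici 0)
  have := (isCompact_Icc (a := (0 : ℝ)) (b := t)).bddAbove_image hc.abs
  rwa [image_eq_range] at this

theorem CkNorm_nonneg (p : ℕ) (t : ℝ) (f : ℝ → ℝ) : 0 ≤ CkNorm p t f :=
  Finset.sum_nonneg fun _ _ => Real.iSup_nonneg fun _ => abs_nonneg _

theorem CkNorm_mono_left {p q : ℕ} (hpq : p ≤ q) (t : ℝ) (f : ℝ → ℝ) :
    CkNorm p t f ≤ CkNorm q t f :=
  Finset.sum_le_sum_of_subset_of_nonneg (Finset.range_mono (by omega))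
    fun _ _ _ => Real.iSup_nonneg fun _ => abs_nonneg _

theorem CkNorm_mono_right {f : ℝ → ℝ} {m p : ℕ} (hf : ContDiffOn ℝ m f (Ici 0)) (hp : p ≤ m)
    {s t : ℝ} (hst : s ≤ t) : CkNorm p s f ≤ CkNorm p t f := by
  refine Finset.sum_le_sum fun l hl => ?_
  have hb := bddAbove_range_abs_iteratedDerivWithin hf
    (show l ≤ m by rw [Finset.mem_range] at hl; omega) t
  refine Real.iSup_le (fun τ => ?_) (Real.iSup_nonneg fun _ => abs_nonneg _)
  exact le_ciSup hb ⟨τ, τ.2.1, τ.2.2.trans hst⟩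

/-- The order of the norms bounding the `k`-th derivative of a convolution of `j` functions. -/
def normOrder (j k : ℕ) : ℕ := if k = 0 then 0 else max (k + 1 - j) 1

theorem sum_zero_pow_div_factorial_le_one (s : Finset ℕ) :
    ∑ l ∈ s, (0 : ℝ) ^ l / (l.factorial : ℝ) ≤ 1 := by
  have h : ∀ l : ℕ, (0 : ℝ) ^ l / (l.factorial : ℝ) = if l = 0 then 1 else 0 := by
    rintro (_ | l) <;> simp
  simp only [h, Finset.sum_ite_eq']
  split_ifs <;> norm_num

theorem sum_zero_pow_div_factorial_Icc_eq_zero {a : ℕ} (ha : 0 < a) (b : ℕ) :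
    ∑ l ∈ Finset.Icc a b, (0 : ℝ) ^ l / (l.factorial : ℝ) = 0 := by
  refine Finset.sum_eq_zero fun l hl => ?_
  rw [zero_pow (by rw [Finset.mem_Icc] at hl; omega), zero_div]

theorem sum_Icc_add_one (u : ℕ → ℝ) (a b : ℕ) :
    ∑ l ∈ Finset.Icc a b, u (l + 1) = ∑ l ∈ Finset.Icc (a + 1) (b + 1), u l := by
  simp [← Finset.image_add_right_Icc, Finset.sum_image]

theorem iteratedDerivWithin_conv_bound {f g : ℝ → ℝ} {m n : ℕ} {P : ℕ → ℝ → ℝ} (hm : 1 ≤ m)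
    (hf : ContDiffOn ℝ m f (Ici 0)) (hg : ContDiffOn ℝ (m + n : ℕ) g (Ici 0))
    (hP₀ : ∀ p t, 0 ≤ P p t) (hP₁ : ∀ p q t, p ≤ q → P p t ≤ P q t)
    (hP₂ : ∀ p ≤ m, ∀ s t, s ≤ t → P p s ≤ P p t)
    (hgP : ∀ k ≤ m + n, ∀ t, 0 ≤ t → |iteratedDerivWithin k g (Ici 0) t| ≤
      (∑ l ∈ Finset.Icc (n - k) n, t ^ l / (l.factorial : ℝ)) * P (normOrder (n + 1) k) t) :
    ContDiffOn ℝ (m + n + 1 : ℕ) (conv f g) (Ici 0) ∧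
      ∀ k ≤ m + n + 1, ∀ t, 0 ≤ t → |iteratedDerivWithin k (conv f g) (Ici 0) t| ≤
        (∑ l ∈ Finset.Icc (n + 1 - k) (n + 1), t ^ l / (l.factorial : ℝ)) *
          (CkNorm (normOrder (n + 2) k) t f * P (normOrder (n + 2) k) t) := by
  have hg₀ : ∀ r < n, iteratedDerivWithin r g (Ici 0) 0 = 0 := fun r hr => by
    have := hgP r (by omega) 0 le_rfl
    rw [sum_zero_pow_div_factorial_Icc_eq_zero (by omega), zero_mul] at this
    exact abs_nonpos_iff.1 this
  obtain ⟨hC, hD⟩ := ContDiffOn.conv_Ici hm hf hg hg₀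
  refine ⟨hC, fun k hk t ht => ?_⟩
  set b : ℕ → ℝ := fun i => ⨆ τ : Icc (0 : ℝ) t, |iteratedDerivWithin i f (Ici 0) τ|
  have hb₀ : ∀ i, 0 ≤ b i := fun i => Real.iSup_nonneg fun _ => abs_nonneg _
  have hfb : ∀ i ≤ m, ∀ x ∈ Icc 0 t, |iteratedDerivWithin i f (Ici 0) x| ≤ b i :=
    fun i hi x hx => le_ciSup (bddAbove_range_abs_iteratedDerivWithin hf hi t) ⟨x, hx⟩
  have hA : ∀ p, CkNorm p t f = ∑ i ∈ Finset.range (p + 1), b i := fun p => rfl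
  have hgP' : ∀ r ≤ m + n, ∀ q ≤ m, normOrder (n + 1) r ≤ q → ∀ x ∈ Icc 0 t,
      |iteratedDerivWithin r g (Ici 0) x| ≤
        (∑ l ∈ Finset.Icc (n - r) n, x ^ l / (l.factorial : ℝ)) * P q t := by
    intro r hr q hq hrq x hx
    refine (hgP r hr x hx.1).trans (mul_le_mul_of_nonneg_left
      ((hP₁ _ _ _ hrq).trans (hP₂ q hq x t hx.2)) (Finset.sum_nonneg fun l _ => ?_))
    have := hx.1
    positivity
  rcases k with _ | r
  · have h := abs_conv_le ht (hb₀ 0) (hfb 0 (by omega)) (hgP' 0 (by omega) 0 (by omega) le_rfl)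
    refine Eq.trans_le ?_ (h.trans_eq ?_)
    · simp
    · simp [hA, normOrder]
      ring
  · set q := normOrder (n + 2) (r + 1) with hq
    have hq' : q = max (r - n) 1 := by
      rw [hq, normOrder, if_neg r.succ_ne_zero]
      omega
    have hqm : q ≤ m := by omega
    have hord : ∀ r' ≤ r, normOrder (n + 1) r' ≤ q := fun r' hr' => by
      simp only [normOrder]; split_ifs <;> omega
    rw [hD r (by omega) t ht, hA]
    set S := ∑ l ∈ Finset.Icc (n + 1 - (r + 1)) (n + 1), t ^ l / (l.factorial : ℝ) with hS
    set S₁ := ∑ l ∈ Finset.Icc (n - r) n, t ^ l / (l.factorial : ℝ)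
    set S₂ := ∑ l ∈ Finset.Icc (n - r) n, t ^ (l + 1) / ((l + 1).factorial : ℝ)
    have hS₂' : S₂ = ∑ l ∈ Finset.Icc (n - r + 1) (n + 1), t ^ l / (l.factorial : ℝ) :=
      sum_Icc_add_one (fun l => t ^ l / (l.factorial : ℝ)) _ _
    have hpos : ∀ l : ℕ, 0 ≤ t ^ l / (l.factorial : ℝ) := fun l => by positivity
    have hS₁S : S₁ ≤ S := Finset.sum_le_sum_of_subset_of_nonneg
      (Finset.Icc_subset_Icc (by omega) (by omega)) fun l _ _ => hpos l
    have hS₂S : S₂ ≤ S := hS₂'.trans_le <| Finset.sum_le_sum_of_subset_of_nonneg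
      (Finset.Icc_subset_Icc (by omega) (by omega)) fun l _ _ => hpos l
    have h0t : (0 : ℝ) ∈ Icc 0 t := ⟨le_rfl, ht⟩
    have htt : t ∈ Icc 0 t := ⟨ht, le_rfl⟩
    have h₁ : |f 0 * iteratedDerivWithin r g (Ici 0) t| ≤ b 0 * (S₁ * P q t) := by
      rw [abs_mul]
      exact mul_le_mul (by simpa using hfb 0 (by omega) 0 h0t)
        (hgP' r (by omega) q hqm (hord r le_rfl) t htt) (abs_nonneg _) (hb₀ 0)
    have h₂ : |conv (iteratedDerivWithin 1 f (Ici 0)) (iteratedDerivWithin r g (Ici 0)) t| ≤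
        b 1 * (S₂ * P q t) :=
      abs_conv_le ht (hb₀ 1) (hfb 1 hm) (hgP' r (by omega) q hqm (hord r le_rfl))
    have h₃ : |∑ i ∈ Finset.range r, iteratedDerivWithin (i + 1) f (Ici 0) t *
        iteratedDerivWithin (r - 1 - i) g (Ici 0) 0| ≤
        (∑ i ∈ Finset.range (r - n), b (i + 1)) * P q t := by
      rw [← Finset.sum_subset (Finset.range_mono (Nat.sub_le r n)) fun i hi hi' => by
        rw [Finset.mem_range] at hi hi'
        rw [hg₀ _ (by omega), mul_zero], Finset.sum_mul]
      refine (Finset.abs_sum_le_sum_abs _ _).trans (Finset.sum_le_sum fun i hi => ?_)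
      rw [Finset.mem_range] at hi
      rw [abs_mul]
      refine mul_le_mul (hfb _ (by omega) t htt) ?_ (abs_nonneg _) (hb₀ _)
      exact (hgP' _ (by omega) q hqm (hord _ (by omega)) 0 h0t).trans
        (mul_le_of_le_one_left (hP₀ _ _) (sum_zero_pow_div_factorial_le_one _))
    refine (abs_add_three _ _ _).trans ((add_le_add_three h₁ h₂ h₃).trans ?_)
    suffices b 0 * S₁ + b 1 * S₂ + ∑ i ∈ Finset.range (r - n), b (i + 1) ≤
        S * ∑ i ∈ Finset.range (q + 1), b i by
      nlinarith [mul_le_mul_of_nonneg_right this (hP₀ q t)]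
    rw [Finset.sum_range_succ']
    have hb0S := mul_le_mul_of_nonneg_left hS₁S (hb₀ 0)
    rcases le_or_gt r n with hrn | hrn
    · have hb1S := mul_le_mul_of_nonneg_left hS₂S (hb₀ 1)
      rw [show q = 1 by omega, Nat.sub_eq_zero_of_le hrn]
      simp only [Finset.range_zero, Finset.sum_empty, Finset.range_one, Finset.sum_singleton,
        zero_add]
      linarith
    · rw [show q = r - n by omega]
      have hS₂1 : S = 1 + S₂ := by
        rw [hS₂', hS, show n + 1 - (r + 1) = 0 by omega, show n - r + 1 = 1 by omega,
          Finset.Icc_eq_cons_Ioc (Nat.zero_le _), Finset.sum_cons]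
        simp [← Finset.Icc_add_one_left_eq_Ioc]
      have hb1 : b 1 ≤ ∑ i ∈ Finset.range (r - n), b (i + 1) :=
        Finset.single_le_sum (f := fun i => b (i + 1)) (fun i _ => hb₀ _)
          (Finset.mem_range.2 (by omega : 0 < r - n))
      have hS₂0 : 0 ≤ S₂ := Finset.sum_nonneg fun l _ => hpos (l + 1)
      have hb1S := mul_le_mul_of_nonneg_right hb1 hS₂0
      rw [hS₂1] at hb0S ⊢
      linarith

theorem prod_map_CkNorm_nonneg (L : List (ℝ → ℝ)) (p : ℕ) (t : ℝ) :
    0 ≤ (L.map (CkNorm p t)).prod :=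
  List.prod_nonneg fun _ ha => by
    obtain ⟨f, -, rfl⟩ := List.mem_map.1 ha
    exact CkNorm_nonneg p t f

theorem convList_bound {m : ℕ} (hm : 1 ≤ m) (L : List (ℝ → ℝ)) (f : ℝ → ℝ)
    (hL : ∀ h ∈ f :: L, ContDiffOn ℝ m h (Ici 0)) :
    ContDiffOn ℝ (m + L.length : ℕ) (convList (f :: L)) (Ici 0) ∧
      ∀ k ≤ m + L.length, ∀ t, 0 ≤ t → |iteratedDerivWithin k (convList (f :: L)) (Ici 0) t| ≤
        (∑ l ∈ Finset.Icc (L.length - k) L.length, t ^ l / (l.factorial : ℝ)) *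
          ((f :: L).map (CkNorm (normOrder (L.length + 1) k) t)).prod := by
  induction L generalizing f with
  | nil =>
    have hf := hL f (by simp)
    refine ⟨hf, fun k hk t ht => ?_⟩
    have hord : normOrder 1 k = k := by simp only [normOrder]; split_ifs <;> omega
    simp only [convList, List.length_nil, Nat.zero_sub, Finset.Icc_self, Finset.sum_singleton,
      pow_zero, Nat.factorial_zero, Nat.cast_one, div_one, one_mul, zero_add, hord,
      List.map_cons, List.map_nil, List.prod_singleton]
    refine (le_ciSup (bddAbove_range_abs_iteratedDerivWithin hf hk t) ⟨t, ht, le_rfl⟩).trans ?_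
    exact Finset.single_le_sum
      (f := fun l => ⨆ τ : Icc (0 : ℝ) t, |iteratedDerivWithin l f (Ici 0) τ|)
      (fun _ _ => Real.iSup_nonneg fun _ => abs_nonneg _) (Finset.self_mem_range_succ k)
  | cons g L ih =>
    obtain ⟨hG, hGP⟩ := ih g fun h hh => hL h (List.mem_cons_of_mem _ hh)
    exact iteratedDerivWithin_conv_bound hm (hL f (by simp)) hG
      (P := fun p t => ((g :: L).map (CkNorm p t)).prod)
      (fun p t => prod_map_CkNorm_nonneg _ p t)
      (fun p q t hpq => List.prod_map_le_prod_map₀ _ _ (fun h _ => CkNorm_nonneg p t h)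
        fun h _ => CkNorm_mono_left hpq t h)
      (fun p hp s t hst => List.prod_map_le_prod_map₀ _ _ (fun h _ => CkNorm_nonneg p s h)
        fun h hh => CkNorm_mono_right (hL h (List.mem_cons_of_mem _ hh)) hp hst) hGP

/-- If `M_1, …, M_j ∈ C^m([0,∞))` (`j, m ≥ 1`), then the iterated convolution
`M_1 * ⋯ * M_j` is of class `C^{m+j-1}` on `[0,∞)`, and for every `0 ≤ k ≤ m+j-1` and `t > 0`,
`|d^k/dt^k (M_1 * ⋯ * M_j)(t)| ≤ (∑_{l=max{0,j-1-k}}^{j-1} t^l/l!) ∏_{l=1}^j ‖M_l‖_{C^p([0,t])}`,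
where `p = 0` if `k = 0` and `p = max{k-j+1, 1}` otherwise. -/
theorem convList_contDiff_and_deriv_bound
    (j m : ℕ) (hj : 1 ≤ j) (hm : 1 ≤ m) (Ms : Fin j → ℝ → ℝ)
    (hMs : ∀ i, ContDiffOn ℝ m (Ms i) (Set.Ici 0)) :
    ContDiffOn ℝ (m + j - 1) (convList (List.ofFn Ms)) (Set.Ici 0) ∧
      ∀ k, k ≤ m + j - 1 → ∀ t : ℝ, 0 < t →
        |iteratedDerivWithin k (convList (List.ofFn Ms)) (Set.Ici 0) t| ≤
          (∑ l ∈ Finset.Icc (j - 1 - k) (j - 1), t ^ l / (l.factorial : ℝ)) *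
            ∏ i : Fin j, CkNorm (if k = 0 then 0 else max (k + 1 - j) 1) t (Ms i) := by
  obtain ⟨n, rfl⟩ : ∃ n, j = n + 1 := ⟨j - 1, by omega⟩
  have h := convList_bound hm (List.ofFn fun i : Fin n => Ms i.succ) (Ms 0) (by
    simpa [Fin.forall_fin_succ] using ⟨hMs 0, fun i => hMs i.succ⟩)
  simp only [← List.ofFn_succ, List.map_ofFn, List.prod_ofFn, List.length_ofFn] at h
  refine ⟨?_, fun k hk t ht => h.2 k hk t ht.le⟩
  convert! h.1 using 1
end

section
/- Let M ∈ C^∞([0,∞), ℝ). Then the series K_M(t,s) := ∑_{j=1}^∞ ((-s)^j / j!) M^{*j}(t-s) converges absolutely at every point (t,s) with t ≥ s, the function K_M is infinitely differentiable on the open half-plane {(t,s) ∈ ℝ² : t > s}, and for all integers α ≥ 0, β ≥ 1 and all t > s one has |∂_t^α ∂_s^β K_M(t,s)| ≤ e^{t-s} · [ exp( β (1+|s|) ‖M‖_{C^{α+β}([0,t-s])} ) − 1 ]. -/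
open Set MeasureTheory

/-- The flow kernel `K_M(t,s) = ∑_{j≥1} ((-s)^j / j!) M^{*j}(t-s)`. -/
noncomputable def KM (M : ℝ → ℝ) (t s : ℝ) : ℝ :=
  ∑' j : ℕ, ((-s) ^ j / (j.factorial : ℝ)) * convPow M j (t - s)

open Filter Topology

theorem continuous_conv {f g : ℝ → ℝ} (hf : Continuous f) (hg : Continuous g) :
    Continuous (conv f g) := by
  have h : Continuous (Function.uncurry fun t s : ℝ => f (t - s) * g s) := by
    simp only [Function.uncurry_def]
    fun_prop
  exact intervalIntegral.continuous_parametric_intervalIntegral_of_continuous h continuous_id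

theorem hasDerivAt_mul_of_continuousAt {c : ℝ → ℝ} {t : ℝ} (hc : ContinuousAt c t) :
    HasDerivAt (fun x => (x - t) * c x) (c t) t := by
  rw [hasDerivAt_iff_tendsto_slope]
  refine (hc.tendsto.mono_left nhdsWithin_le_nhds).congr' ?_
  filter_upwards [self_mem_nhdsWithin] with x hx
  have : x - t ≠ 0 := sub_ne_zero.mpr hx
  simp [slope_def_field, this]

theorem hasDerivAt_integral_moving_endpoint {u g : ℝ → ℝ} (hu : Continuous u)
    (hg : Continuous g) (t : ℝ) :
    HasDerivAt (fun x => ∫ s in t..x, u (x - s) * g s) (u 0 * g t) t := by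
  have h : Continuous fun x => ∫ r in (0:ℝ)..1, u (x - (t + (x - t) * r)) * g (t + (x - t) * r) :=
    intervalIntegral.continuous_parametric_intervalIntegral_of_continuous' (by
      simp only [Function.uncurry_def]
      fun_prop) 0 1
  convert hasDerivAt_mul_of_continuousAt (t := t) h.continuousAt using 1
  · ext x
    have := intervalIntegral.smul_integral_comp_add_mul (a := 0) (b := 1)
      (fun s => u (x - s) * g s) (x - t) t
    simpa using this.symm
  · simp

/-- Derivative of a convolution whose first factor is `C^1` on the whole line. -/
theorem hasDerivAt_conv_of_forall_hasDerivAt {u u' g : ℝ → ℝ} (hu' : Continuous u')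
    (hg : Continuous g) (hd : ∀ x, HasDerivAt u (u' x) x) (t : ℝ) :
    HasDerivAt (conv u g) (u 0 * g t + conv u' g t) t := by
  have hu : Continuous u := continuous_iff_continuousAt.mpr fun x => (hd x).continuousAt
  have hint (a b x : ℝ) : IntervalIntegrable (fun s => u (x - s) * g s) volume a b :=
    Continuous.intervalIntegrable (by fun_prop) a b
  have hsplit : conv u g =
      fun x => (∫ s in t..x, u (x - s) * g s) + ∫ s in (0:ℝ)..t, u (x - s) * g s := by
    ext x
    rw [add_comm, intervalIntegral.integral_add_adjacent_intervals (hint _ _ _) (hint _ _ _), conv]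
  rw [hsplit]
  refine (hasDerivAt_integral_moving_endpoint hu hg t).add ?_
  have hK : IsCompact (Metric.closedBall t 1 ×ˢ uIcc 0 t) :=
    (isCompact_closedBall t 1).prod isCompact_uIcc
  obtain ⟨C, hC⟩ := hK.exists_bound_of_continuousOn
    (f := fun p : ℝ × ℝ => u' (p.1 - p.2) * g p.2)
    (by fun_prop)
  refine (intervalIntegral.hasDerivAt_integral_of_dominated_loc_of_deriv_le
    (s := Metric.closedBall t 1) (bound := fun _ => C)
    (F' := fun x s => u' (x - s) * g s)
    (Metric.closedBall_mem_nhds t one_pos) ?_ (hint _ _ _) ?_ ?_ (by simp) ?_).2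
  · exact Eventually.of_forall fun x =>
      Continuous.aestronglyMeasurable (by fun_prop)
  · exact Continuous.aestronglyMeasurable (by fun_prop)
  · exact Eventually.of_forall fun s hs x hx => hC (x, s) ⟨hx, uIoc_subset_uIcc hs⟩
  · refine Eventually.of_forall fun s _ x _ => ?_
    simpa using ((hd (x - s)).comp x ((hasDerivAt_id x).sub_const s)).mul_const (g s)

theorem conv_congr_s4 {f₁ f₂ g₁ g₂ : ℝ → ℝ} {t : ℝ} (ht : 0 ≤ t)
    (hf : ∀ x, 0 ≤ x → f₁ x = f₂ x) (hg : ∀ x, 0 ≤ x → g₁ x = g₂ x) :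
    conv f₁ g₁ t = conv f₂ g₂ t := by
  refine intervalIntegral.integral_congr fun s hs => ?_
  rw [uIcc_of_le ht] at hs
  simp only [hf (t - s) (sub_nonneg.mpr hs.2), hg s hs.1]

/-- Derivative of a convolution whose first factor is differentiable on `(0,∞)` only. -/
theorem hasDerivAt_conv_s4 {u u' g : ℝ → ℝ} (hu : Continuous u) (hu' : Continuous u')
    (hg : Continuous g) (hd : ∀ x, 0 < x → HasDerivAt u (u' x) x) {t : ℝ} (ht : 0 < t) :
    HasDerivAt (conv u g) (u 0 * g t + conv u' g t) t := by
  have hv (x : ℝ) : HasDerivAt (fun x => u 0 + ∫ y in (0:ℝ)..x, u' y) (u' x) x :=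
    (intervalIntegral.integral_hasDerivAt_right (hu'.intervalIntegrable _ _)
      hu'.aestronglyMeasurable.stronglyMeasurableAtFilter hu'.continuousAt).const_add _
  have huv (x : ℝ) (hx : 0 ≤ x) : u x = u 0 + ∫ y in (0:ℝ)..x, u' y := by
    rw [intervalIntegral.integral_eq_sub_of_hasDerivAt_of_le hx hu.continuousOn
      (fun y hy => hd y hy.1) (hu'.intervalIntegrable _ _)]
    ring
  have := hasDerivAt_conv_of_forall_hasDerivAt hu' hg hv t
  simp only [intervalIntegral.integral_same, add_zero] at this
  refine this.congr_of_eventuallyEq ?_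
  filter_upwards [Ioi_mem_nhds ht] with x hx
  exact conv_congr_s4 (le_of_lt hx) huv fun _ _ => rfl

/-- The `n`-th derivative of `M` on `[0,∞)`, extended to `(-∞,0)` by its value at `0`. -/
noncomputable def derivJet (M : ℝ → ℝ) (n : ℕ) (x : ℝ) : ℝ :=
  iteratedDerivWithin n M (Ici 0) (max x 0)

/-- The formal `n`-th derivative of the `j`-fold convolution power of `M`. -/
noncomputable def convPowJet (M : ℝ → ℝ) : ℕ → ℕ → ℝ → ℝ
  | 0, _ => fun _ => 0
  | 1, n => derivJet M n
  | (j + 2), n => fun x =>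
      ∑ l ∈ Finset.range n, derivJet M l 0 * convPowJet M (j + 1) (n - 1 - l) x +
        conv (derivJet M n) (convPowJet M (j + 1) 0) x

section Jet

variable {M : ℝ → ℝ}

theorem derivJet_zero {x : ℝ} (hx : 0 ≤ x) : derivJet M 0 x = M x := by
  simp [derivJet, max_eq_left hx]

theorem continuous_derivJet (hM : ContDiffOn ℝ (⊤ : ℕ∞) M (Ici 0)) (n : ℕ) :
    Continuous (derivJet M n) :=
  (hM.continuousOn_iteratedDerivWithin (by exact_mod_cast le_top)
    (uniqueDiffOn_Ici 0)).comp_continuous (by fun_prop) fun x => le_max_right x 0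

theorem hasDerivAt_derivJet (hM : ContDiffOn ℝ (⊤ : ℕ∞) M (Ici 0)) (n : ℕ) {x : ℝ} (hx : 0 < x) :
    HasDerivAt (derivJet M n) (derivJet M (n + 1) x) x := by
  have h := (hM.differentiableOn_iteratedDerivWithin (m := n)
    (by exact_mod_cast ENat.natCast_lt_top n) (uniqueDiffOn_Ici 0) x hx.le).hasDerivWithinAt
  rw [← iteratedDerivWithin_succ] at h
  have h' := h.hasDerivAt (Ici_mem_nhds hx)
  rw [derivJet, max_eq_left hx.le]
  refine h'.congr_of_eventuallyEq ?_
  filter_upwards [Ioi_mem_nhds hx] with y hy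
  rw [derivJet, max_eq_left (le_of_lt hy)]

theorem continuous_convPowJet (hM : ContDiffOn ℝ (⊤ : ℕ∞) M (Ici 0)) (j n : ℕ) :
    Continuous (convPowJet M j n) := by
  induction j generalizing n with
  | zero => exact continuous_const
  | succ j ih =>
    cases j with
    | zero => exact continuous_derivJet hM n
    | succ j =>
      exact (continuous_finsetSum _ fun l _ => continuous_const.mul (ih _)).add
        (continuous_conv (continuous_derivJet hM n) (ih 0))

theorem hasDerivAt_convPowJet (hM : ContDiffOn ℝ (⊤ : ℕ∞) M (Ici 0)) (j n : ℕ) {x : ℝ}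
    (hx : 0 < x) : HasDerivAt (convPowJet M j n) (convPowJet M j (n + 1) x) x := by
  induction j generalizing n with
  | zero => exact hasDerivAt_const x 0
  | succ j ih =>
    cases j with
    | zero => exact hasDerivAt_derivJet hM n hx
    | succ j =>
      have hsum : HasDerivAt
          (fun x => ∑ l ∈ Finset.range n, derivJet M l 0 * convPowJet M (j + 1) (n - 1 - l) x)
          (∑ l ∈ Finset.range n, derivJet M l 0 * convPowJet M (j + 1) (n - l) x) x := by
        refine HasDerivAt.fun_sum fun l hl => ?_
        have hl' : n - l = n - 1 - l + 1 := by
          have := Finset.mem_range.mp hl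
          omega
        rw [hl']
        exact (ih _).const_mul _
      have hconv := hasDerivAt_conv_s4 (continuous_derivJet hM n) (continuous_derivJet hM (n + 1))
        (continuous_convPowJet hM (j + 1) 0) (fun y hy => hasDerivAt_derivJet hM n hy) hx
      refine (hsum.add hconv).congr_deriv ?_
      simp only [convPowJet, Finset.sum_range_succ, Nat.add_sub_cancel, Nat.sub_self]
      ring

theorem convPowJet_zero (j : ℕ) {x : ℝ} (hx : 0 ≤ x) : convPowJet M j 0 x = convPow M j x := by
  induction j generalizing x with
  | zero => rfl
  | succ j ih =>
    cases j with
    | zero => exact derivJet_zero hx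
    | succ j =>
      simp only [convPowJet, convPow, Finset.range_zero, Finset.sum_empty, zero_add]
      exact conv_congr_s4 hx (fun y hy => derivJet_zero hy) fun y hy => ih hy

theorem abs_derivJet_le (hM : ContDiffOn ℝ (⊤ : ℕ∞) M (Ici 0)) (n : ℕ) {x T : ℝ} (hx : 0 ≤ x)
    (hxT : x ≤ T) :
    |derivJet M n x| ≤ ⨆ τ : Icc (0:ℝ) T, |iteratedDerivWithin n M (Ici 0) τ| := by
  have hc : ContinuousOn (fun τ => |iteratedDerivWithin n M (Ici 0) τ|) (Icc 0 T) :=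
    ((hM.continuousOn_iteratedDerivWithin (m := n) (by exact_mod_cast le_top)
      (uniqueDiffOn_Ici 0)).mono Icc_subset_Ici_self).abs
  have hb := isCompact_Icc.bddAbove_image hc
  rw [image_eq_range] at hb
  rw [derivJet, max_eq_left hx]
  exact le_ciSup hb (⟨x, hx, hxT⟩ : Icc (0:ℝ) T)

theorem CkNorm_nonneg_s4 (k : ℕ) (T : ℝ) : 0 ≤ CkNorm k T M :=
  Finset.sum_nonneg fun _ _ => Real.iSup_nonneg fun _ => abs_nonneg _

theorem CkNorm_mono {k n : ℕ} (h : n ≤ k) (T : ℝ) : CkNorm n T M ≤ CkNorm k T M :=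
  Finset.sum_le_sum_of_subset_of_nonneg (Finset.range_subset_range.mpr (by omega))
    fun _ _ _ => Real.iSup_nonneg fun _ => abs_nonneg _

theorem abs_conv_le_s4 {f g : ℝ → ℝ} {A B t : ℝ} (ht : 0 ≤ t) (hf : Continuous f) (hg : Continuous g)
    (hA : ∀ x, 0 ≤ x → x ≤ t → |f x| ≤ A) (hB : ∀ x, 0 ≤ x → x ≤ t → |g x| ≤ Real.exp x * B) :
    |conv f g t| ≤ A * B * (Real.exp t - 1) := by
  calc |conv f g t| ≤ ∫ s in (0:ℝ)..t, |f (t - s) * g s| :=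
        intervalIntegral.abs_integral_le_integral_abs ht
    _ ≤ ∫ s in (0:ℝ)..t, A * B * Real.exp s := by
        refine intervalIntegral.integral_mono_on ht
          (Continuous.intervalIntegrable (by fun_prop) _ _)
          (Continuous.intervalIntegrable (by fun_prop) _ _) fun s hs => ?_
        have h1 := hA (t - s) (sub_nonneg.mpr hs.2) (by linarith [hs.1])
        rw [abs_mul]
        calc _ ≤ A * (Real.exp s * B) :=
              mul_le_mul h1 (hB s hs.1 hs.2) (abs_nonneg _) ((abs_nonneg _).trans h1)
          _ = _ := by ring
    _ = _ := by simp

theorem abs_convPowJet_le (hM : ContDiffOn ℝ (⊤ : ℕ∞) M (Ici 0)) {k n : ℕ} (hn : n ≤ k) (j : ℕ)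
    {x T : ℝ} (hx : 0 ≤ x) (hxT : x ≤ T) :
    |convPowJet M j n x| ≤ Real.exp x * CkNorm k T M ^ j := by
  have hN : 0 ≤ CkNorm k T M := CkNorm_nonneg_s4 k T
  induction j generalizing n x with
  | zero => simpa [convPowJet] using (Real.exp_pos x).le
  | succ j ih =>
    set a : ℕ → ℝ := fun l => ⨆ τ : Icc (0:ℝ) T, |iteratedDerivWithin l M (Ici 0) τ| with ha
    have ha0 (l : ℕ) : 0 ≤ a l := Real.iSup_nonneg fun _ => abs_nonneg _
    have hsum : ∑ l ∈ Finset.range (n + 1), a l ≤ CkNorm k T M := CkNorm_mono hn T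
    cases j with
    | zero =>
      have h1 : a n ≤ CkNorm k T M :=
        (Finset.single_le_sum (fun l _ => ha0 l) (Finset.self_mem_range_succ n)).trans hsum
      calc |convPowJet M 1 n x| ≤ a n := abs_derivJet_le hM n hx hxT
        _ ≤ 1 * CkNorm k T M ^ 1 := by simpa using h1
        _ ≤ _ := by
          gcongr
          exact Real.one_le_exp hx
    | succ j =>
      set B := CkNorm k T M ^ (j + 1) with hB
      have hB0 : 0 ≤ B := by positivity
      have hconv : |conv (derivJet M n) (convPowJet M (j + 1) 0) x| ≤
          a n * B * (Real.exp x - 1) :=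
        abs_conv_le_s4 hx (continuous_derivJet hM n) (continuous_convPowJet hM _ _)
          (fun y hy hyx => abs_derivJet_le hM n hy (hyx.trans hxT))
          fun y hy hyx => ih (Nat.zero_le k) hy (hyx.trans hxT)
      have hterms : |∑ l ∈ Finset.range n, derivJet M l 0 * convPowJet M (j + 1) (n - 1 - l) x| ≤
          ∑ l ∈ Finset.range n, a l * (Real.exp x * B) := by
        refine (Finset.abs_sum_le_sum_abs _ _).trans (Finset.sum_le_sum fun l _ => ?_)
        rw [abs_mul]
        exact mul_le_mul (abs_derivJet_le hM l le_rfl (hx.trans hxT))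
          (ih (by omega) hx hxT) (abs_nonneg _) (ha0 l)
      calc |convPowJet M (j + 2) n x|
          ≤ ∑ l ∈ Finset.range n, a l * (Real.exp x * B) + a n * B * (Real.exp x - 1) :=
            (abs_add_le _ _).trans (add_le_add hterms hconv)
        _ ≤ ∑ l ∈ Finset.range n, a l * (Real.exp x * B) + a n * (Real.exp x * B) := by
            nlinarith [mul_nonneg (ha0 n) hB0]
        _ = (∑ l ∈ Finset.range (n + 1), a l) * (Real.exp x * B) := by
            rw [Finset.sum_range_succ, add_mul, Finset.sum_mul]
        _ ≤ CkNorm k T M * (Real.exp x * B) := by gcongr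
        _ = _ := by rw [hB]; ring

end Jet

/-- The `i`-th derivative of `s ↦ (-s)^j / j!`. -/
noncomputable def expCoeff (i j : ℕ) (s : ℝ) : ℝ :=
  if i ≤ j then (-1) ^ i * ((-s) ^ (j - i) / ((j - i).factorial : ℝ)) else 0

theorem hasDerivAt_expCoeff (i j : ℕ) (s : ℝ) :
    HasDerivAt (expCoeff i j) (expCoeff (i + 1) j s) s := by
  rcases lt_trichotomy i j with h | rfl | h
  · obtain ⟨k, rfl⟩ := Nat.exists_eq_add_of_lt h
    have e1 : expCoeff i (i + k + 1) =
        fun s => (-1) ^ i * ((-s) ^ (k + 1) / ((k + 1).factorial : ℝ)) := by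
      ext s
      rw [expCoeff, if_pos (by omega), show i + k + 1 - i = k + 1 by omega]
    have e2 : expCoeff (i + 1) (i + k + 1) s = (-1) ^ (i + 1) * ((-s) ^ k / (k.factorial : ℝ)) := by
      rw [expCoeff, if_pos (by omega), show i + k + 1 - (i + 1) = k by omega]
    rw [e1, e2]
    refine ((((hasDerivAt_id s).neg.pow (k + 1)).div_const _).const_mul _).congr_deriv ?_
    have : (k.factorial : ℝ) ≠ 0 := by positivity
    simp only [Nat.factorial_succ, Nat.cast_mul, Nat.add_sub_cancel, Pi.neg_apply, id]
    field_simp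
    ring
  · simpa [funext fun s => show expCoeff i i s = (-1) ^ i by simp [expCoeff],
      expCoeff] using hasDerivAt_const s ((-1 : ℝ) ^ i)
  · have e (s : ℝ) (l : ℕ) (hl : i ≤ l) : expCoeff l j s = 0 := by
      rw [expCoeff, if_neg (by omega)]
    simpa [funext fun s => e s i le_rfl, e s (i + 1) (by omega)] using hasDerivAt_const s (0 : ℝ)

theorem abs_expCoeff (i j : ℕ) (s : ℝ) :
    |expCoeff i j s| = if i ≤ j then |s| ^ (j - i) / ((j - i).factorial : ℝ) else 0 := by
  rw [expCoeff]
  split_ifs <;> simp [abs_div]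

theorem abs_expCoeff_mono (i j : ℕ) {s S : ℝ} (h : |s| ≤ |S|) :
    |expCoeff i j s| ≤ |expCoeff i j S| := by
  rw [abs_expCoeff, abs_expCoeff]
  split_ifs
  · gcongr
  · rfl

theorem summable_abs_expCoeff_mul_pow (i : ℕ) (s N : ℝ) :
    Summable fun j => |expCoeff i j s| * N ^ j := by
  rw [← summable_nat_add_iff i]
  refine ((Real.summable_pow_div_factorial (|s| * N)).mul_left (N ^ i)).congr fun j => ?_
  rw [abs_expCoeff, if_pos (by omega), Nat.add_sub_cancel, mul_pow, pow_add]
  ring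

theorem sum_choose_mul_abs_expCoeff_le {b : ℕ} (hb : 1 ≤ b) (j : ℕ) (s : ℝ) :
    ∑ i ∈ Finset.range (b + 1), (b.choose i : ℝ) * |expCoeff i j s| ≤
      ((b : ℝ) * (1 + |s|)) ^ j / (j.factorial : ℝ) := by
  have hb' : (1:ℝ) ≤ b := by exact_mod_cast hb
  calc ∑ i ∈ Finset.range (b + 1), (b.choose i : ℝ) * |expCoeff i j s|
      ≤ ∑ i ∈ Finset.range (b + j + 1), (b.choose i : ℝ) * |expCoeff i j s| :=
        Finset.sum_le_sum_of_subset_of_nonneg (Finset.range_subset_range.mpr (by omega))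
          fun _ _ _ => by positivity
    _ = ∑ i ∈ Finset.range (j + 1), (b.choose i : ℝ) * |expCoeff i j s| := by
        refine (Finset.sum_subset (Finset.range_subset_range.mpr (by omega)) fun i _ hi => ?_).symm
        have : ¬ i ≤ j := by simpa [Nat.lt_succ_iff] using hi
        rw [abs_expCoeff, if_neg this, mul_zero]
    _ ≤ ∑ i ∈ Finset.range (j + 1),
          (b : ℝ) ^ j * (1 ^ i * |s| ^ (j - i) * (j.choose i : ℝ) / (j.factorial : ℝ)) := by
        refine Finset.sum_le_sum fun i hi => ?_
        have hij : i ≤ j := Nat.lt_succ_iff.mp (Finset.mem_range.mp hi)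
        have hch : (b.choose i : ℝ) ≤ (b : ℝ) ^ j / (i.factorial : ℝ) :=
          (Nat.choose_le_pow_div i b).trans (by gcongr)
        rw [abs_expCoeff, if_pos hij, Nat.cast_choose ℝ hij]
        calc _ ≤ (b : ℝ) ^ j / (i.factorial : ℝ) * (|s| ^ (j - i) / ((j - i).factorial : ℝ)) := by
              gcongr
          _ = _ := by
              field_simp
              simp
    _ = _ := by
        rw [← Finset.mul_sum, ← Finset.sum_div, ← add_pow, mul_pow, mul_div_assoc]

/-- The kernel series in the variables `τ = t - s` and `s`, differentiated term by term `i` times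
in `s` and `n` times in `τ`. -/
noncomputable def kernelJet (M : ℝ → ℝ) (i n : ℕ) (τ s : ℝ) : ℝ :=
  ∑' j : ℕ, expCoeff i j s * convPowJet M j n τ

section Kernel

variable {M : ℝ → ℝ}

theorem KM_eq_kernelJet {t s : ℝ} (h : s ≤ t) : KM M t s = kernelJet M 0 0 (t - s) s := by
  refine tsum_congr fun j => ?_
  rw [convPowJet_zero j (sub_nonneg.mpr h)]
  simp [expCoeff]

theorem summable_abs_kernelJet (hM : ContDiffOn ℝ (⊤ : ℕ∞) M (Ici 0)) (i n : ℕ) {τ : ℝ}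
    (hτ : 0 ≤ τ) (s : ℝ) : Summable fun j => |expCoeff i j s * convPowJet M j n τ| := by
  refine Summable.of_nonneg_of_le (fun j => abs_nonneg _) (fun j => ?_)
    ((summable_abs_expCoeff_mul_pow i s (CkNorm n τ M)).mul_left (Real.exp τ))
  rw [abs_mul]
  calc _ ≤ |expCoeff i j s| * (Real.exp τ * CkNorm n τ M ^ j) := by
        gcongr
        exact abs_convPowJet_le hM le_rfl j hτ le_rfl
    _ = _ := by ring

theorem hasFDerivAt_kernelJet (hM : ContDiffOn ℝ (⊤ : ℕ∞) M (Ici 0)) (i n : ℕ) {p : ℝ × ℝ}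
    (hp : 0 < p.1) :
    HasFDerivAt (fun p : ℝ × ℝ => kernelJet M i n p.1 p.2)
      (kernelJet M i (n + 1) p.1 p.2 • ContinuousLinearMap.fst ℝ ℝ ℝ +
        kernelJet M (i + 1) n p.1 p.2 • ContinuousLinearMap.snd ℝ ℝ ℝ) p := by
  set T := p.1 + 1 with hT
  set S := |p.2| + 1 with hS
  set N := CkNorm (n + 1) T M with hN
  have hS0 : 0 ≤ S := by positivity
  set f' : ℕ → ℝ × ℝ → ℝ × ℝ →L[ℝ] ℝ := fun j q =>
    (expCoeff i j q.2 * convPowJet M j (n + 1) q.1) • ContinuousLinearMap.fst ℝ ℝ ℝ +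
      (expCoeff (i + 1) j q.2 * convPowJet M j n q.1) • ContinuousLinearMap.snd ℝ ℝ ℝ with hf'
  have hsum1 := (summable_abs_kernelJet hM i (n + 1) hp.le p.2).of_abs
  have hsum2 := (summable_abs_kernelJet hM (i + 1) n hp.le p.2).of_abs
  have htsum : ∑' j, f' j p = kernelJet M i (n + 1) p.1 p.2 • ContinuousLinearMap.fst ℝ ℝ ℝ +
        kernelJet M (i + 1) n p.1 p.2 • ContinuousLinearMap.snd ℝ ℝ ℝ :=
    ((hsum1.hasSum.smul_const _).add (hsum2.hasSum.smul_const _)).tsum_eq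
  rw [← htsum]
  have hmem : p ∈ Ioo 0 T ×ˢ Ioo (-S) S := by
    refine ⟨⟨hp, by linarith⟩, ?_⟩
    rw [mem_Ioo, ← abs_lt]
    linarith
  have hu : Summable fun j => Real.exp T * (|expCoeff i j S| * N ^ j) +
      Real.exp T * (|expCoeff (i + 1) j S| * N ^ j) :=
    ((summable_abs_expCoeff_mul_pow i S N).mul_left _).add
      ((summable_abs_expCoeff_mul_pow (i + 1) S N).mul_left _)
  refine hasFDerivAt_tsum_of_isPreconnected (s := Ioo 0 T ×ˢ Ioo (-S) S) (f' := f') (x₀ := p)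
    (f := fun j q => expCoeff i j q.2 * convPowJet M j n q.1) hu
    (isOpen_Ioo.prod isOpen_Ioo) ((convex_Ioo _ _).prod (convex_Ioo _ _)).isPreconnected
    (fun j q hq => ?_) (fun j q hq => ?_) hmem (summable_abs_kernelJet hM i n hp.le p.2).of_abs hmem
  · have h1 := (hasDerivAt_expCoeff i j q.2).comp_hasFDerivAt q (hasFDerivAt_snd (𝕜 := ℝ) (p := q))
    have h2 := (hasDerivAt_convPowJet hM j n hq.1.1).comp_hasFDerivAt q
      (hasFDerivAt_fst (𝕜 := ℝ) (p := q))
    refine (h1.mul h2).congr_fderiv ?_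
    simp only [hf', Function.comp_apply, smul_smul]
    rw [mul_comm (convPowJet M j n q.1)]
  · have hq2 : |q.2| ≤ |S| := by
      rw [abs_of_nonneg hS0]
      exact (abs_lt.mpr hq.2).le
    have key (a l : ℕ) (hl : l ≤ n + 1) :
        |expCoeff a j q.2 * convPowJet M j l q.1| ≤ Real.exp T * (|expCoeff a j S| * N ^ j) := by
      rw [abs_mul]
      calc _ ≤ |expCoeff a j S| * (Real.exp q.1 * N ^ j) :=
            mul_le_mul (abs_expCoeff_mono a j hq2) (abs_convPowJet_le hM hl j hq.1.1.le hq.1.2.le)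
              (abs_nonneg _) (abs_nonneg _)
        _ ≤ |expCoeff a j S| * (Real.exp T * N ^ j) := by
            have : 0 ≤ N := CkNorm_nonneg_s4 _ _
            gcongr
            exact hq.1.2.le
        _ = _ := by ring
    refine (norm_add_le _ _).trans (add_le_add ?_ ?_)
    · rw [norm_smul]
      exact (mul_le_of_le_one_right (norm_nonneg _)
        (ContinuousLinearMap.norm_fst_le ℝ ℝ ℝ)).trans (key i (n + 1) le_rfl)
    · rw [norm_smul]
      exact (mul_le_of_le_one_right (norm_nonneg _)
        (ContinuousLinearMap.norm_snd_le ℝ ℝ ℝ)).trans (key (i + 1) n (by omega))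

theorem contDiffOn_kernelJet (hM : ContDiffOn ℝ (⊤ : ℕ∞) M (Ici 0)) (i n : ℕ) :
    ContDiffOn ℝ (⊤ : ℕ∞) (fun p : ℝ × ℝ => kernelJet M i n p.1 p.2) {p | 0 < p.1} := by
  have ho : IsOpen {p : ℝ × ℝ | 0 < p.1} := isOpen_lt continuous_const continuous_fst
  rw [contDiffOn_infty]
  intro k
  induction k generalizing i n with
  | zero =>
    exact contDiffOn_zero.mpr fun p hp =>
      (hasFDerivAt_kernelJet hM i n hp).continuousAt.continuousWithinAt
  | succ k ih =>
    push_cast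
    refine (contDiffOn_succ_iff_hasFDerivWithinAt_of_uniqueDiffOn ho.uniqueDiffOn).mpr
      ⟨fun h => absurd h (by simp), _, ?_,
        fun p hp => (hasFDerivAt_kernelJet hM i n hp).hasFDerivWithinAt⟩
    exact ((ih i (n + 1)).smul contDiffOn_const).add ((ih (i + 1) n).smul contDiffOn_const)

theorem contDiffOn_KM (hM : ContDiffOn ℝ (⊤ : ℕ∞) M (Ici 0)) :
    ContDiffOn ℝ (⊤ : ℕ∞) (fun p : ℝ × ℝ => KM M p.1 p.2) {p : ℝ × ℝ | p.2 < p.1} := by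
  have h : ContDiff ℝ (⊤ : ℕ∞) fun p : ℝ × ℝ => (p.1 - p.2, p.2) := by fun_prop
  have hmaps : MapsTo (fun p : ℝ × ℝ => (p.1 - p.2, p.2)) {p | p.2 < p.1} {p | 0 < p.1} :=
    fun p hp => mem_ofPred.mpr (sub_pos.mpr hp)
  exact ((contDiffOn_kernelJet hM 0 0).comp h.contDiffOn hmaps).congr
    fun p hp => KM_eq_kernelJet (le_of_lt hp)

theorem hasDerivAt_kernelJet_left (hM : ContDiffOn ℝ (⊤ : ℕ∞) M (Ici 0)) (i n : ℕ) {t s : ℝ}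
    (h : s < t) :
    HasDerivAt (fun t => kernelJet M i n (t - s) s) (kernelJet M i (n + 1) (t - s) s) t := by
  have hc : HasDerivAt (fun t => (t - s, s)) ((1 : ℝ), (0 : ℝ)) t :=
    ((hasDerivAt_id t).sub_const s).prodMk (hasDerivAt_const t s)
  have hd := (hasFDerivAt_kernelJet hM i n (p := (t - s, s)) (sub_pos.mpr h)).comp_hasDerivAt t hc
  exact hd.congr_deriv (by simp)

theorem hasDerivAt_kernelJet_right (hM : ContDiffOn ℝ (⊤ : ℕ∞) M (Ici 0)) (i n : ℕ) {t s : ℝ}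
    (h : s < t) :
    HasDerivAt (fun s => kernelJet M i n (t - s) s)
      (kernelJet M (i + 1) n (t - s) s - kernelJet M i (n + 1) (t - s) s) s := by
  have hc : HasDerivAt (fun s => (t - s, s)) ((-1 : ℝ), (1 : ℝ)) s :=
    ((hasDerivAt_id s).const_sub t).prodMk (hasDerivAt_id s)
  have hd := HasFDerivAt.comp_hasDerivAt (f := fun s => (t - s, s)) s
    (hasFDerivAt_kernelJet hM i n (p := (t - s, s)) (sub_pos.mpr h)) hc
  refine hd.congr_deriv ?_
  simp
  ring

end Kernel

theorem iteratedDeriv_eq_of_hasDerivAt {U : Set ℝ} (hU : IsOpen U) {f : ℝ → ℝ} {F : ℕ → ℝ → ℝ}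
    (h0 : ∀ x ∈ U, f x = F 0 x) (hF : ∀ n, ∀ x ∈ U, HasDerivAt (F n) (F (n + 1) x) x) (n : ℕ)
    {x : ℝ} (hx : x ∈ U) : iteratedDeriv n f x = F n x := by
  induction n generalizing x with
  | zero => simpa using h0 x hx
  | succ n ih =>
    rw [iteratedDeriv_succ]
    refine ((hF n x hx).congr_of_eventuallyEq ?_).deriv
    filter_upwards [hU.mem_nhds hx] with y hy using ih hy

section Kernel

variable {M : ℝ → ℝ}

theorem iteratedDeriv_KM_left (hM : ContDiffOn ℝ (⊤ : ℕ∞) M (Ici 0)) (α : ℕ) {t s : ℝ}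
    (h : s < t) : iteratedDeriv α (fun t => KM M t s) t = kernelJet M 0 α (t - s) s :=
  iteratedDeriv_eq_of_hasDerivAt (F := fun n t => kernelJet M 0 n (t - s) s) isOpen_Ioi
    (fun _ hx => KM_eq_kernelJet (le_of_lt hx)) (fun n _ hx => hasDerivAt_kernelJet_left hM 0 n hx)
    α (mem_Ioi.mpr h)

theorem iteratedDeriv_KM (hM : ContDiffOn ℝ (⊤ : ℕ∞) M (Ici 0)) (α β : ℕ) {t s : ℝ}
    (h : s < t) :
    iteratedDeriv β (fun s' => iteratedDeriv α (fun t' => KM M t' s') t) s =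
      ∑ i ∈ Finset.range (β + 1),
        (β.choose i : ℝ) * ((-1) ^ (β - i) * kernelJet M i (α + (β - i)) (t - s) s) := by
  refine iteratedDeriv_eq_of_hasDerivAt (U := Iio t) (F := fun b s => ∑ i ∈ Finset.range (b + 1),
    (b.choose i : ℝ) * ((-1) ^ (b - i) * kernelJet M i (α + (b - i)) (t - s) s)) isOpen_Iio
    (fun s hs => ?_) (fun b s hs => ?_) β (mem_Iio.mpr h)
  · simpa using iteratedDeriv_KM_left hM α hs
  · rw [Finset.sum_choose_succ_mul
      (fun i l => (-1) ^ l * kernelJet M i (α + l) (t - s) s) b, ← Finset.sum_add_distrib]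
    refine HasDerivAt.fun_sum fun i hi => ?_
    have hib : b + 1 - i = b - i + 1 := by
      have := Finset.mem_range.mp hi
      omega
    refine (((hasDerivAt_kernelJet_right hM i (α + (b - i)) hs).const_mul _).const_mul
      _).congr_deriv ?_
    rw [hib, pow_succ, ← add_assoc α]
    ring

theorem abs_iteratedDeriv_KM_le (hM : ContDiffOn ℝ (⊤ : ℕ∞) M (Ici 0)) {α β : ℕ} (hβ : 1 ≤ β)
    {t s : ℝ} (h : s < t) :
    |iteratedDeriv β (fun s' => iteratedDeriv α (fun t' => KM M t' s') t) s| ≤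
      Real.exp (t - s) * (Real.exp ((β : ℝ) * (1 + |s|) * CkNorm (α + β) (t - s) M) - 1) := by
  rw [iteratedDeriv_KM hM α β h]
  set τ := t - s with hτ
  have hτ0 : 0 ≤ τ := sub_nonneg.mpr h.le
  set N := CkNorm (α + β) τ M with hN
  have hN0 : 0 ≤ N := CkNorm_nonneg_s4 _ _
  set b : ℕ → ℝ := fun j => if j = 0 then 0 else Real.exp τ * N ^ j with hb
  have hb0 (j : ℕ) : 0 ≤ b j := by
    simp only [hb]
    split_ifs <;> positivity
  have hbsum (i : ℕ) : Summable fun j => |expCoeff i j s| * b j := by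
    refine Summable.of_nonneg_of_le (fun j => mul_nonneg (abs_nonneg _) (hb0 j)) (fun j => ?_)
      ((summable_abs_expCoeff_mul_pow i s N).mul_left (Real.exp τ))
    simp only [hb]
    split_ifs
    · simpa using by positivity
    · exact le_of_eq (by ring)
  have hjet (i n : ℕ) (hn : n ≤ α + β) :
      |kernelJet M i n τ s| ≤ ∑' j, |expCoeff i j s| * b j := by
    refine tsum_of_norm_bounded (f := fun j => expCoeff i j s * convPowJet M j n τ)
      (hbsum i).hasSum fun j => ?_
    rw [Real.norm_eq_abs, abs_mul]
    refine mul_le_mul_of_nonneg_left ?_ (abs_nonneg _)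
    rcases j with _ | j
    · simp [convPowJet, hb]
    · simpa [hb] using abs_convPowJet_le hM hn (j + 1) hτ0 le_rfl
  have hexp : HasSum (fun j : ℕ => Real.exp τ *
      (((β : ℝ) * (1 + |s|) * N) ^ j / (j.factorial : ℝ) - if j = 0 then 1 else 0))
      (Real.exp τ * (Real.exp ((β : ℝ) * (1 + |s|) * N) - 1)) := by
    refine HasSum.mul_left _ (HasSum.sub ?_ (hasSum_ite_eq 0 1))
    rw [Real.exp_eq_exp_ℝ]
    exact NormedSpace.expSeries_div_hasSum_exp _
  calc _ ≤ ∑ i ∈ Finset.range (β + 1), (β.choose i : ℝ) * ∑' j, |expCoeff i j s| * b j := by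
        refine (Finset.abs_sum_le_sum_abs _ _).trans (Finset.sum_le_sum fun i _ => ?_)
        rw [abs_mul, abs_mul, abs_pow, abs_neg, abs_one, one_pow, one_mul, Nat.abs_cast]
        exact mul_le_mul_of_nonneg_left (hjet i _ (by omega)) (Nat.cast_nonneg _)
    _ ≤ _ := by
        refine hasSum_le (fun j => ?_)
          (hasSum_sum fun i _ => (hbsum i).hasSum.mul_left (β.choose i : ℝ)) hexp
        simp only [← mul_assoc]
        rw [← Finset.sum_mul]
        rcases j with _ | j
        · simp [hb]
        · refine (mul_le_mul_of_nonneg_right (sum_choose_mul_abs_expCoeff_le hβ _ s)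
            (hb0 _)).trans (le_of_eq ?_)
          simp only [hb, Nat.add_eq_zero_iff, one_ne_zero, and_false, if_false, sub_zero]
          rw [mul_pow _ N]
          ring

end Kernel

/-- For `M ∈ C^∞([0,∞))`: the series defining `K_M(t,s)` converges absolutely
whenever `t ≥ s`; `K_M` is `C^∞` on the open half-plane `{t > s}`; and for all integers
`α ≥ 0`, `β ≥ 1` and all `t > s`,
`|∂_t^α ∂_s^β K_M(t,s)| ≤ e^{t-s} (exp(β(1+|s|)‖M‖_{C^{α+β}([0,t-s])}) − 1)`. -/
theorem KM_summable_smooth_and_mixed_deriv_bound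
    (M : ℝ → ℝ) (hM : ContDiffOn ℝ (⊤ : ℕ∞) M (Set.Ici 0)) :
    (∀ t s : ℝ, s ≤ t →
        Summable (fun j : ℕ => |((-s) ^ j / (j.factorial : ℝ)) * convPow M j (t - s)|)) ∧
      ContDiffOn ℝ (⊤ : ℕ∞) (fun p : ℝ × ℝ => KM M p.1 p.2) {p : ℝ × ℝ | p.2 < p.1} ∧
      ∀ (α β : ℕ), 1 ≤ β → ∀ t s : ℝ, s < t →
        |iteratedDeriv β (fun s' => iteratedDeriv α (fun t' => KM M t' s') t) s| ≤
          Real.exp (t - s) *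
            (Real.exp ((β : ℝ) * (1 + |s|) * CkNorm (α + β) (t - s) M) - 1) := by
  refine ⟨fun t s h => ?_, contDiffOn_KM hM, fun α β hβ t s h => abs_iteratedDeriv_KM_le hM hβ h⟩
  refine (summable_abs_kernelJet hM 0 0 (sub_nonneg.mpr h) s).congr fun j => ?_
  rw [convPowJet_zero j (sub_nonneg.mpr h)]
  simp [expCoeff]
end

section
/- Suppose M : ℝ → ℝ is real analytic on all of ℝ. Define iterated convolutions for every real argument by M^{*1} := M and M^{*(j+1)}(τ) := ∫_0^τ M(τ-r) M^{*j}(r) dr (a signed interval integral, valid also for τ < 0). Then the function K(t,s) := ∑_{j=1}^∞ ((-s)^j / j!) M^{*j}(t-s) is real analytic on all of ℝ²; in particular, the flow kernel K_M is real analytic at every point of S_+ := {(t,s) ∈ ℝ² : t ≥ s}. -/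
open Set MeasureTheory

/-- A function that is real analytic at a point extends holomorphically to a complex ball. -/
lemma exists_local_holomorphic_extension {f : ℝ → ℝ} {x : ℝ} (hf : AnalyticAt ℝ f x) :
    ∃ r > 0, ∃ G : ℂ → ℂ, DifferentiableOn ℂ G (Metric.ball (x : ℂ) r) ∧
      ∀ y : ℝ, |y - x| < r → G y = f y := by
  obtain ⟨p, R, hp⟩ := hf
  obtain ⟨r, hr0, hrR⟩ := ENNReal.lt_iff_exists_nnreal_btwn.1 hp.r_pos
  have hr : (0 : ℝ) < r := by exact_mod_cast hr0
  have hsum : Summable fun n => ‖p n‖ * (r : ℝ) ^ n :=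
    p.summable_norm_mul_pow (hrR.trans_le hp.r_le)
  refine ⟨r, hr, fun z => ∑' n, (p.coeff n : ℂ) * (z - x) ^ n, ?_, ?_⟩
  · refine Complex.differentiableOn_tsum_of_summable_norm hsum (fun n => by fun_prop)
      Metric.isOpen_ball fun n z hz => ?_
    have hz' : ‖z - x‖ ≤ r := by
      rw [mem_ball_iff_norm] at hz
      exact hz.le
    rw [norm_mul, norm_pow, Complex.norm_real, ← p.norm_apply_eq_norm_coef]
    gcongr
  · intro y hy
    have hy' : y - x ∈ Metric.eball (0 : ℝ) R := by
      refine Metric.eball_subset_eball hrR.le ?_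
      rw [Metric.eball_coe]
      simpa using hy
    have h := hp.hasSum hy'
    have h2 := Complex.hasSum_ofReal.2 h
    rw [add_sub_cancel] at h2
    rw [← h2.tsum_eq]
    refine tsum_congr fun n => ?_
    rw [FormalMultilinearSeries.apply_eq_pow_smul_coeff]
    push_cast [smul_eq_mul]
    ring

/-- The complex derivatives of a holomorphic extension restrict to the real derivatives. -/
lemma iteratedDeriv_holomorphic_extension {f : ℝ → ℝ} (hf : AnalyticOnNhd ℝ f univ) {G : ℂ → ℂ}
    {x r : ℝ} (hG : DifferentiableOn ℂ G (Metric.ball (x : ℂ) r))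
    (hGf : ∀ y : ℝ, |y - x| < r → G y = f y) (n : ℕ) :
    ∀ y : ℝ, |y - x| < r → iteratedDeriv n G y = (iteratedDeriv n f y : ℝ) := by
  have mem_ball : ∀ y : ℝ, |y - x| < r → (y : ℂ) ∈ Metric.ball (x : ℂ) r := fun y hy => by
    rw [mem_ball_iff_norm, ← Complex.ofReal_sub, Complex.norm_real]
    exact hy
  induction n with
  | zero => simpa using hGf
  | succ n ih =>
    intro y hy
    rw [iteratedDeriv_succ, iteratedDeriv_succ]
    have hGn : AnalyticAt ℂ (iteratedDeriv n G) y := by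
      rw [iteratedDeriv_eq_iterate]
      exact (hG.analyticAt (Metric.isOpen_ball.mem_nhds (mem_ball y hy))).iterated_deriv n
    have hfn : AnalyticAt ℝ (iteratedDeriv n f) y := by
      rw [iteratedDeriv_eq_iterate]
      exact (hf y (mem_univ y)).iterated_deriv n
    have h1 := hGn.differentiableAt.hasDerivAt.comp_ofReal
    have h2 := hfn.differentiableAt.hasDerivAt.ofReal_comp
    refine h1.unique (h2.congr_of_eventuallyEq ?_)
    have : ∀ᶠ u in nhds y, |u - x| < r :=
      (continuous_abs.comp (continuous_id.sub continuous_const)).continuousAt.eventually_lt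
        continuousAt_const hy
    filter_upwards [this] with u hu using ih u hu

/-- A real analytic function on `ℝ` is the restriction of a function holomorphic near `ℝ`. -/
lemma exists_holomorphic_extension {f : ℝ → ℝ} (hf : AnalyticOnNhd ℝ f univ) :
    ∃ F : ℂ → ℂ, (∀ x : ℝ, AnalyticAt ℂ F x) ∧ ∀ x : ℝ, F x = f x := by
  let F : ℂ → ℂ := fun z => ∑' n : ℕ,
    ((n.factorial : ℂ)⁻¹ * (iteratedDeriv n f z.re : ℝ) * (z - z.re) ^ n)
  have key : ∀ x : ℝ, ∃ ρ > 0, ∃ G : ℂ → ℂ, DifferentiableOn ℂ G (Metric.ball (x : ℂ) ρ) ∧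
      (∀ y : ℝ, |y - x| < ρ → G y = f y) ∧ EqOn F G (Metric.ball (x : ℂ) ρ) := by
    intro x
    obtain ⟨r, hr, G, hG, hGf⟩ := exists_local_holomorphic_extension (hf x (mem_univ x))
    have hsub : Metric.ball (x : ℂ) (r / 2) ⊆ Metric.ball (x : ℂ) r :=
      Metric.ball_subset_ball (by linarith)
    refine ⟨r / 2, half_pos hr, G, hG.mono hsub, fun y hy => hGf y (by linarith), ?_⟩
    intro z hz
    rw [mem_ball_iff_norm] at hz
    have hre : |z.re - x| < r / 2 := by
      have := Complex.abs_re_le_norm (z - x)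
      simp only [Complex.sub_re, Complex.ofReal_re] at this
      linarith
    have him : z ∈ Metric.ball (z.re : ℂ) (r / 2) := by
      rw [mem_ball_iff_norm]
      have h1 : z - z.re = (z.im : ℂ) * Complex.I := by
        apply Complex.ext <;> simp
      rw [h1, norm_mul, Complex.norm_I, mul_one, Complex.norm_real]
      have := Complex.abs_im_le_norm (z - x)
      simp only [Complex.sub_im, Complex.ofReal_im, sub_zero] at this
      exact this.trans_lt hz
    have hball : Metric.ball (z.re : ℂ) (r / 2) ⊆ Metric.ball (x : ℂ) r := by
      refine Metric.ball_subset_ball' ?_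
      rw [dist_eq_norm, ← Complex.ofReal_sub, Complex.norm_real, Real.norm_eq_abs]
      linarith
    rw [← Complex.taylorSeries_eq_on_ball' him (hG.mono hball)]
    refine tsum_congr fun n => ?_
    rw [iteratedDeriv_holomorphic_extension hf hG hGf n z.re (by linarith)]
  refine ⟨F, fun x => ?_, fun x => ?_⟩
  · obtain ⟨ρ, hρ, G, hG, -, hFG⟩ := key x
    have hnhds := Metric.ball_mem_nhds (x : ℂ) hρ
    exact (hG.analyticAt hnhds).congr (hFG.eventuallyEq_of_mem hnhds).symm
  · obtain ⟨ρ, hρ, G, -, hGf, hFG⟩ := key x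
    rw [hFG (Metric.mem_ball_self hρ), hGf x (by simpa using hρ)]

/-- Convolution of complex functions along the segment from `0` to `z`. -/
noncomputable def complexConv (F g : ℂ → ℂ) (z : ℂ) : ℂ :=
  ∫ u in (0 : ℝ)..1, z * F (z - u * z) * g (u * z)

lemma complexConv_ofReal {F g : ℂ → ℂ} {f h : ℝ → ℝ} (hF : ∀ x : ℝ, F x = f x)
    (hg : ∀ x : ℝ, g x = h x) (x : ℝ) : complexConv F g x = conv f h x := by
  have h1 : conv f h x = ∫ u in (0 : ℝ)..1, x * f (x - u * x) * h (u * x) := by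
    have := intervalIntegral.smul_integral_comp_mul_right (a := 0) (b := 1)
      (fun s => f (x - s) * h s) x
    rw [zero_mul, one_mul] at this
    rw [conv, ← this, smul_eq_mul, ← intervalIntegral.integral_const_mul]
    simp only [mul_assoc]
  rw [h1, complexConv, ← intervalIntegral.integral_ofReal]
  congr 1
  ext u
  have e1 : (x : ℂ) - u * x = ((x - u * x : ℝ) : ℂ) := by push_cast; ring
  have e2 : (u : ℂ) * x = ((u * x : ℝ) : ℂ) := by push_cast; ring
  rw [e1, e2, hF, hg]
  push_cast
  ring

lemma segment_mem {U : Set ℂ} (hconv : Convex ℝ U) (h0 : (0 : ℂ) ∈ U) {z : ℂ} (hz : z ∈ U)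
    {u : ℝ} (hu : u ∈ Icc (0 : ℝ) 1) : (u : ℂ) * z ∈ U ∧ z - u * z ∈ U := by
  have h1 := hconv.smul_mem_of_zero_mem h0 hz hu
  have h2 := hconv.smul_mem_of_zero_mem h0 hz
    (t := 1 - u) ⟨by linarith [hu.2], by linarith [hu.1]⟩
  rw [Complex.real_smul] at h1 h2
  refine ⟨h1, ?_⟩
  convert h2 using 1
  push_cast
  ring

lemma differentiableOn_complexConv {U : Set ℂ} (hU : IsOpen U) (hconv : Convex ℝ U)
    (h0 : (0 : ℂ) ∈ U) {F g : ℂ → ℂ} (hF : DifferentiableOn ℂ F U)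
    (hg : DifferentiableOn ℂ g U) : DifferentiableOn ℂ (complexConv F g) U := by
  intro z₀ hz₀
  obtain ⟨ε, hε, hball⟩ := Metric.nhds_basis_closedBall.mem_iff.1 (hU.mem_nhds hz₀)
  let Φ : ℂ → ℝ → ℂ := fun z u => z * F (z - u * z) * g (u * z)
  let Φ' : ℂ → ℝ → ℂ := fun z u => (1 * F (z - u * z) + z * (deriv F (z - u * z) * (1 - u * 1))) *
    g (u * z) + z * F (z - u * z) * (deriv g (u * z) * (u * 1))
  have hmaps : ∀ p ∈ Metric.closedBall z₀ ε ×ˢ Icc (0 : ℝ) 1,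
      ((p.2 : ℝ) : ℂ) * p.1 ∈ U ∧ p.1 - p.2 * p.1 ∈ U :=
    fun p hp => segment_mem hconv h0 (hball hp.1) hp.2
  have c1 : ContinuousOn (fun p : ℂ × ℝ => (p.2 : ℂ) * p.1)
      (Metric.closedBall z₀ ε ×ˢ Icc (0 : ℝ) 1) := by fun_prop
  have c2 : ContinuousOn (fun p : ℂ × ℝ => p.1 - (p.2 : ℂ) * p.1)
      (Metric.closedBall z₀ ε ×ˢ Icc (0 : ℝ) 1) := by fun_prop
  have cF := hF.continuousOn.comp c2 fun p hp => (hmaps p hp).2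
  have cF' := (hF.deriv hU).continuousOn.comp c2 fun p hp => (hmaps p hp).2
  have cg := hg.continuousOn.comp c1 fun p hp => (hmaps p hp).1
  have cg' := (hg.deriv hU).continuousOn.comp c1 fun p hp => (hmaps p hp).1
  simp only [Function.comp_def] at cF cF' cg cg'
  have cΦ : ContinuousOn (fun p : ℂ × ℝ => Φ p.1 p.2)
      (Metric.closedBall z₀ ε ×ˢ Icc (0 : ℝ) 1) := by
    exact (continuousOn_fst.mul cF).mul cg
  have cu : ContinuousOn (fun p : ℂ × ℝ => (p.2 : ℂ) * 1)
      (Metric.closedBall z₀ ε ×ˢ Icc (0 : ℝ) 1) := by fun_prop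
  have cΦ' : ContinuousOn (fun p : ℂ × ℝ => Φ' p.1 p.2)
      (Metric.closedBall z₀ ε ×ˢ Icc (0 : ℝ) 1) := by
    exact (((continuousOn_const.mul cF).add (continuousOn_fst.mul
      (cF'.mul (continuousOn_const.sub cu)))).mul cg).add
      ((continuousOn_fst.mul cF).mul (cg'.mul cu))
  obtain ⟨C, hC⟩ := ((isCompact_closedBall z₀ ε).prod isCompact_Icc).exists_bound_of_continuousOn
    cΦ'
  have slice : ∀ {Ψ : ℂ → ℝ → ℂ}, ContinuousOn (fun p : ℂ × ℝ => Ψ p.1 p.2)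
      (Metric.closedBall z₀ ε ×ˢ Icc (0 : ℝ) 1) → ∀ z ∈ Metric.closedBall z₀ ε,
      IntervalIntegrable (Ψ z) volume 0 1 := by
    intro Ψ hΨ z hz
    refine ContinuousOn.intervalIntegrable ?_
    rw [uIcc_of_le zero_le_one]
    exact hΨ.comp (f := fun u : ℝ => (z, u)) (by fun_prop) fun u hu => ⟨hz, hu⟩
  have hz₀ε : z₀ ∈ Metric.closedBall z₀ ε := Metric.mem_closedBall_self hε.le
  have hnhds := Metric.closedBall_mem_nhds z₀ hε
  have meas : ∀ {Ψ : ℝ → ℂ}, IntervalIntegrable Ψ volume 0 1 →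
      AEStronglyMeasurable Ψ (volume.restrict (uIoc 0 1)) := fun h => h.def'.aestronglyMeasurable
  have hIcc : ∀ u ∈ uIoc (0 : ℝ) 1, u ∈ Icc (0 : ℝ) 1 := fun u hu => by
    rw [uIoc_of_le zero_le_one] at hu
    exact Ioc_subset_Icc_self hu
  refine (intervalIntegral.hasDerivAt_integral_of_dominated_loc_of_deriv_le (F := Φ) (F' := Φ')
    (bound := fun _ => C) hnhds ?_ (slice cΦ z₀ hz₀ε) (meas (slice cΦ' z₀ hz₀ε)) ?_
    intervalIntegrable_const ?_).2.differentiableAt.differentiableWithinAt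
  · filter_upwards [hnhds] with z hz using meas (slice cΦ z hz)
  · exact Filter.Eventually.of_forall fun u hu z hz => hC (z, u) ⟨hz, hIcc u hu⟩
  · refine Filter.Eventually.of_forall fun u hu z hz => ?_
    obtain ⟨m1, m2⟩ := segment_mem hconv h0 (hball hz) (hIcc u hu)
    have d1 : HasDerivAt (fun z : ℂ => (u : ℂ) * z) (u * 1) z := (hasDerivAt_id z).const_mul _
    have d2 : HasDerivAt (fun z : ℂ => z - (u : ℂ) * z) (1 - u * 1) z := (hasDerivAt_id z).sub d1
    have dF := (hF.differentiableAt (hU.mem_nhds m2)).hasDerivAt.comp z d2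
    have dg := (hg.differentiableAt (hU.mem_nhds m1)).hasDerivAt.comp z d1
    exact ((hasDerivAt_id z).mul dF).mul dg

lemma norm_complexConv_le {U : Set ℂ} (hconv : Convex ℝ U) (h0 : (0 : ℂ) ∈ U) {F g : ℂ → ℂ}
    {B C D : ℝ} (hB : ∀ z ∈ U, ‖z‖ ≤ B) (hF : ∀ z ∈ U, ‖F z‖ ≤ C) (hg : ∀ z ∈ U, ‖g z‖ ≤ D)
    {z : ℂ} (hz : z ∈ U) : ‖complexConv F g z‖ ≤ B * C * D := by
  have hB0 : 0 ≤ B := (norm_nonneg _).trans (hB z hz)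
  have hC0 : 0 ≤ C := (norm_nonneg _).trans (hF z hz)
  have h : ‖complexConv F g z‖ ≤ B * C * D * |(1 : ℝ) - 0| := by
    refine intervalIntegral.norm_integral_le_of_norm_le_const fun u hu => ?_
    rw [uIoc_of_le zero_le_one] at hu
    obtain ⟨m1, m2⟩ := segment_mem hconv h0 hz (Ioc_subset_Icc_self hu)
    rw [norm_mul, norm_mul]
    gcongr
    exacts [hB z hz, hF _ m2, hg _ m1]
  simpa using h

/-- The convolution powers of a complex function, indexed as in `convPow`. -/
noncomputable def complexConvPow (F : ℂ → ℂ) : ℕ → ℂ → ℂ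
  | 0 => fun _ => 0
  | 1 => F
  | (j + 2) => complexConv F (complexConvPow F (j + 1))

lemma complexConvPow_ofReal {F : ℂ → ℂ} {f : ℝ → ℝ} (hF : ∀ x : ℝ, F x = f x) (j : ℕ) :
    ∀ x : ℝ, complexConvPow F j x = convPow f j x := by
  induction j using Nat.twoStepInduction with
  | zero => simp [complexConvPow, convPow]
  | one => exact hF
  | more j _ ih => exact complexConv_ofReal hF ih

lemma differentiableOn_complexConvPow {U : Set ℂ} (hU : IsOpen U) (hconv : Convex ℝ U)
    (h0 : (0 : ℂ) ∈ U) {F : ℂ → ℂ} (hF : DifferentiableOn ℂ F U) (j : ℕ) :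
    DifferentiableOn ℂ (complexConvPow F j) U := by
  induction j using Nat.twoStepInduction with
  | zero => exact differentiableOn_const _
  | one => exact hF
  | more j _ ih => exact differentiableOn_complexConv hU hconv h0 hF ih

lemma norm_complexConvPow_le {U : Set ℂ} (hconv : Convex ℝ U) (h0 : (0 : ℂ) ∈ U) {F : ℂ → ℂ}
    {B C : ℝ} (hB : ∀ z ∈ U, ‖z‖ ≤ B) (hB1 : 1 ≤ B) (hF : ∀ z ∈ U, ‖F z‖ ≤ C) (j : ℕ) :
    ∀ z ∈ U, ‖complexConvPow F j z‖ ≤ (B * C) ^ j := by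
  have hC0 : 0 ≤ C := (norm_nonneg _).trans (hF 0 h0)
  induction j using Nat.twoStepInduction with
  | zero => simp [complexConvPow]
  | one =>
    intro z hz
    rw [pow_one]
    exact (hF z hz).trans (le_mul_of_one_le_left hC0 hB1)
  | more j _ ih =>
    intro z hz
    rw [pow_succ']
    exact norm_complexConv_le hconv h0 hB hF ih hz

/-- The Cauchy integral over a circle, as a functional on continuous functions on that circle. -/
lemma exists_cauchy_functional (c : ℂ) {r : ℝ} (hr : 0 < r) :
    ∃ Λ : C(Metric.sphere c r, ℂ) →L[ℂ] ℂ, ∀ (h : C(Metric.sphere c r, ℂ)) (f : ℂ → ℂ),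
      (∀ x : Metric.sphere c r, h x = f x) →
        Λ h = (2 * Real.pi * Complex.I : ℂ)⁻¹ • ∮ z in C(c, r), f z := by
  let γ : ℝ → Metric.sphere c r := fun θ => ⟨circleMap c r θ, circleMap_mem_sphere c hr.le θ⟩
  have hγ : Continuous γ := (continuous_circleMap c r).subtype_mk _
  have hd : Continuous (deriv (circleMap c r)) := by
    rw [funext (deriv_circleMap c r)]
    fun_prop
  have hcont : ∀ h : C(Metric.sphere c r, ℂ),
      Continuous fun θ => deriv (circleMap c r) θ • h (γ θ) :=
    fun h => hd.smul (h.continuous.comp hγ)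
  let L : C(Metric.sphere c r, ℂ) →ₗ[ℂ] ℂ :=
    { toFun := fun h => (2 * Real.pi * Complex.I : ℂ)⁻¹ •
        ∫ θ in (0 : ℝ)..2 * Real.pi, deriv (circleMap c r) θ • h (γ θ)
      map_add' := fun h k => by
        rw [← smul_add, ← intervalIntegral.integral_add
          ((hcont h).intervalIntegrable _ _) ((hcont k).intervalIntegrable _ _)]
        simp only [ContinuousMap.add_apply, smul_add]
      map_smul' := fun a h => by
        simp only [ContinuousMap.smul_apply, smul_comm _ a, intervalIntegral.integral_smul,
          RingHom.id_apply] }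
  refine ⟨L.mkContinuous (‖(2 * Real.pi * Complex.I : ℂ)⁻¹‖ * (r * |2 * Real.pi - 0|)) ?_, ?_⟩
  · intro h
    change ‖(2 * Real.pi * Complex.I : ℂ)⁻¹ •
      ∫ θ in (0 : ℝ)..2 * Real.pi, deriv (circleMap c r) θ • h (γ θ)‖ ≤ _
    rw [norm_smul, mul_assoc ‖_‖]
    refine mul_le_mul_of_nonneg_left ?_ (norm_nonneg _)
    rw [mul_right_comm]
    refine intervalIntegral.norm_integral_le_of_norm_le_const fun θ _ => ?_
    rw [norm_smul]
    refine mul_le_mul ?_ (h.norm_coe_le_norm _) (norm_nonneg _) hr.le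
    simp [deriv_circleMap, abs_of_pos hr]
  · intro h f hf
    change (2 * Real.pi * Complex.I : ℂ)⁻¹ •
      ∫ θ in (0 : ℝ)..2 * Real.pi, deriv (circleMap c r) θ • h (γ θ) = _
    simp only [circleIntegral, hf, γ]

/-- A power series in `s` whose coefficients are holomorphic functions of `w` of at most
exponential growth, divided by `j!`, is jointly analytic. -/
lemma analyticAt_tsum_pow_div_factorial {U : Set ℂ} (hU : IsOpen U) {f : ℕ → ℂ → ℂ} {A : ℝ}
    (hf : ∀ j, DifferentiableOn ℂ (f j) U) (hA : ∀ j, ∀ z ∈ U, ‖f j z‖ ≤ A ^ j) {w₀ : ℂ}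
    (hw₀ : w₀ ∈ U) (s₀ : ℂ) :
    AnalyticAt ℂ (fun p : ℂ × ℂ => ∑' j : ℕ, ((-p.2) ^ j / (j.factorial : ℂ)) * f j p.1)
      (w₀, s₀) := by
  obtain ⟨r, hr, hball⟩ := Metric.nhds_basis_closedBall.mem_iff.1 (hU.mem_nhds hw₀)
  have hA0 : 0 ≤ A := by simpa using (norm_nonneg _).trans (hA 1 w₀ hw₀)
  have hsph : ∀ x : Metric.sphere w₀ r, (x : ℂ) ∈ U :=
    fun x => hball (Metric.sphere_subset_closedBall x.2)
  obtain ⟨Λ, hΛ⟩ := exists_cauchy_functional w₀ hr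
  let g : ℕ → C(Metric.sphere w₀ r, ℂ) := fun j =>
    ⟨fun x => f j x, (hf j).continuousOn.comp_continuous continuous_subtype_val hsph⟩
  have hg : ∀ j, ‖g j‖ ≤ A ^ j := fun j =>
    (ContinuousMap.norm_le _ (pow_nonneg hA0 j)).2 fun x => hA j x (hsph x)
  let ζ : C(Metric.sphere w₀ r, ℂ) := ⟨fun x => x, continuous_subtype_val⟩
  let P : ℂ → C(Metric.sphere w₀ r, ℂ) := fun w => Ring.inverse (ζ - w • 1)
  let G : ℂ → C(Metric.sphere w₀ r, ℂ) := fun s => ∑' j : ℕ, ((-s) ^ j / (j.factorial : ℂ)) • g j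
  have hne : ∀ w ∈ Metric.ball w₀ r, ∀ x : Metric.sphere w₀ r, (x : ℂ) - w ≠ 0 := by
    intro w hw x hx
    rw [← sub_eq_zero.1 hx] at hw
    exact (Metric.mem_ball.1 hw).ne x.2
  have hunit : ∀ w ∈ Metric.ball w₀ r, IsUnit (ζ - w • 1) := fun w hw =>
    ContinuousMap.isUnit_iff_forall_ne_zero _ |>.2 fun x => by simpa [ζ] using hne w hw x
  have hPx : ∀ w ∈ Metric.ball w₀ r, ∀ x, P w x = ((x : ℂ) - w)⁻¹ := by
    intro w hw x
    have h := congrArg (fun k : C(Metric.sphere w₀ r, ℂ) => k x)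
      (Ring.inverse_mul_cancel _ (hunit w hw))
    refine eq_inv_of_mul_eq_one_left ?_
    simpa [ζ, P] using h
  have hterm : ∀ (S : ℝ) (j : ℕ) (s : ℂ), ‖s‖ ≤ S →
      ‖((-s) ^ j / (j.factorial : ℂ)) • g j‖ ≤ (S * A) ^ j / (j.factorial : ℝ) := by
    intro S j s hs
    rw [norm_smul, norm_div, norm_pow, norm_neg, Complex.norm_natCast, mul_pow, div_mul_eq_mul_div]
    have := (norm_nonneg s).trans hs
    gcongr
    exact hg j
  have hGan : AnalyticAt ℂ G s₀ := by
    have hd : DifferentiableOn ℂ G (Metric.ball 0 (‖s₀‖ + 1)) := by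
      refine Complex.differentiableOn_tsum_of_summable_norm
        (Real.summable_pow_div_factorial ((‖s₀‖ + 1) * A)) (fun j => ?_) Metric.isOpen_ball
        fun j s hs => hterm _ j s (mem_ball_zero_iff.1 hs).le
      exact DifferentiableOn.smul_const (by fun_prop) (g j)
    exact hd.analyticAt (Metric.isOpen_ball.mem_nhds (by simp))
  have hPan : AnalyticAt ℂ P w₀ := by
    obtain ⟨v, hv⟩ := hunit w₀ (Metric.mem_ball_self hr)
    refine AnalyticAt.fun_comp (g := Ring.inverse) ?_ ?_
    · rw [← hv]
      exact analyticAt_inverse v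
    · exact analyticAt_const.sub (analyticAt_id.smul analyticAt_const)
  have hmain : AnalyticAt ℂ (fun p : ℂ × ℂ => Λ (P p.1 * G p.2)) (w₀, s₀) := by
    refine (Λ.analyticAt _).fun_comp ?_
    exact (AnalyticAt.fun_comp (x := (w₀, s₀)) hPan analyticAt_fst).mul (AnalyticAt.fun_comp (x := (w₀, s₀)) hGan analyticAt_snd)
  refine hmain.congr ?_
  have hnhds : ∀ᶠ p : ℂ × ℂ in nhds (w₀, s₀), p.1 ∈ Metric.ball w₀ r :=
    continuousAt_fst.eventually (Metric.ball_mem_nhds w₀ hr)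
  filter_upwards [hnhds] with p hp
  have hGsum : Summable fun j : ℕ => ((-p.2) ^ j / (j.factorial : ℂ)) • g j :=
    .of_norm_bounded (Real.summable_pow_div_factorial (‖p.2‖ * A))
      fun j => hterm _ j p.2 le_rfl
  have h1 := (Λ.comp (ContinuousLinearMap.mul ℂ _ (P p.1))).map_tsum hGsum
  change Λ (P p.1 * G p.2) = _ at h1
  rw [h1]
  refine tsum_congr fun j => ?_
  rw [map_smul, smul_eq_mul]
  congr 1
  change Λ (P p.1 * g j) = _
  rw [hΛ (P p.1 * g j) (fun z => (z - p.1)⁻¹ • f j z) fun x => by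
    rw [ContinuousMap.mul_apply, hPx p.1 hp, smul_eq_mul]; rfl]
  exact ((hf j).mono hball).diffContOnCl_ball (Metric.closedBall_subset_closedBall le_rfl)
    |>.two_pi_i_inv_smul_circleIntegral_sub_inv_smul hp

/-- If `M : ℝ → ℝ` is real analytic on all of `ℝ`, then the flow kernel
`K(t,s) = ∑_{j≥1} ((-s)^j/j!) M^{*j}(t-s)` (convolutions taken as signed interval integrals,
valid for all real arguments) is real analytic on all of `ℝ²`; in particular it is analytic
at every point of `S_+ = {(t,s) : t ≥ s}`. -/
theorem KM_analytic (M : ℝ → ℝ) (hM : AnalyticOnNhd ℝ M Set.univ) :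
    AnalyticOnNhd ℝ (fun p : ℝ × ℝ => KM M p.1 p.2) Set.univ ∧
      ∀ t s : ℝ, s ≤ t → AnalyticAt ℝ (fun p : ℝ × ℝ => KM M p.1 p.2) (t, s) := by
  suffices h : ∀ t s : ℝ, AnalyticAt ℝ (fun p : ℝ × ℝ => KM M p.1 p.2) (t, s) from
    ⟨fun p _ => h p.1 p.2, fun t s _ => h t s⟩
  intro t₀ s₀
  obtain ⟨F, hFan, hFM⟩ := exists_holomorphic_extension hM
  let K : Set ℂ := segment ℝ 0 ((t₀ - s₀ : ℝ) : ℂ)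
  have hKc : IsCompact K := by
    rw [show K = _ from segment_eq_image_lineMap ℝ 0 ((t₀ - s₀ : ℝ) : ℂ)]
    exact isCompact_Icc.image AffineMap.lineMap_continuous
  have hKsub : K ⊆ {z | AnalyticAt ℂ F z} := by
    rintro z ⟨a, b, -, -, -, rfl⟩
    have := hFan (b * (t₀ - s₀))
    simpa using this
  obtain ⟨δ, hδ, hδsub⟩ := hKc.exists_cthickening_subset_open (isOpen_analyticAt ℂ F) hKsub
  have hcomp : IsCompact (Metric.cthickening δ K) := hKc.cthickening
  have hUsub := Metric.thickening_subset_cthickening δ K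
  have hUo : IsOpen (Metric.thickening δ K) := Metric.isOpen_thickening
  have hUc : Convex ℝ (Metric.thickening δ K) := (convex_segment _ _).thickening δ
  have h0 : (0 : ℂ) ∈ Metric.thickening δ K :=
    Metric.self_subset_thickening hδ K (left_mem_segment ℝ _ _)
  have hw : ((t₀ - s₀ : ℝ) : ℂ) ∈ Metric.thickening δ K :=
    Metric.self_subset_thickening hδ K (right_mem_segment ℝ _ _)
  obtain ⟨B, hB⟩ := hcomp.exists_bound_of_continuousOn (f := fun z : ℂ => z) continuousOn_id
  obtain ⟨C, hC⟩ := hcomp.exists_bound_of_continuousOn (f := F)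
    fun z hz => (hδsub hz).continuousAt.continuousWithinAt
  have hFd : DifferentiableOn ℂ F (Metric.thickening δ K) :=
    fun z hz => (hδsub (hUsub hz)).differentiableAt.differentiableWithinAt
  have hjoint := analyticAt_tsum_pow_div_factorial hUo
    (differentiableOn_complexConvPow hUo hUc h0 hFd)
    (norm_complexConvPow_le hUc h0 (B := max B 1)
      (fun z hz => (hB z (hUsub hz)).trans (le_max_left _ _)) (le_max_right _ _)
      (fun z hz => hC z (hUsub hz))) hw (s₀ : ℂ)
  have hι : AnalyticAt ℝ (fun p : ℝ × ℝ => (((p.1 - p.2 : ℝ) : ℂ), (p.2 : ℂ))) (t₀, s₀) :=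
    ((Complex.ofRealCLM.analyticAt _).fun_comp (analyticAt_fst.sub analyticAt_snd)).prod
      ((Complex.ofRealCLM.analyticAt _).fun_comp analyticAt_snd)
  have hre := (Complex.reCLM.analyticAt _).fun_comp
    ((hjoint.restrictScalars (𝕜 := ℝ)).fun_comp_of_eq hι rfl)
  refine hre.congr (Filter.Eventually.of_forall fun p => ?_)
  change Complex.re _ = KM M p.1 p.2
  rw [KM, ← Complex.ofReal_re (∑' j : ℕ, _), Complex.ofReal_tsum]
  congr 1
  refine tsum_congr fun j => ?_
  rw [complexConvPow_ofReal hFM j]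
  push_cast
  rfl
end
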